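/- (Stability Lemma.) Under the setup below, define g(ξ) = 1 if |ξ| ≤ 3 and g(ξ) = |ξ|^{−s} w₁(|ξ|) (log|ξ|)^{n+1} if |ξ| > 3. Then for every δ > 0, every M₀ > 0, and every compactly supported C^K function χ on ℝ^{mn}, there exists M* ∈ 𝓜 with M* ≥ M₀ such that |(χ F_{M*})^∧(ξ) − χ̂(ξ)| ≤ δ g(ξ) for all ξ ∈ ℝ^{mn}, where ^∧ denotes the Fourier transform on ℝ^{mn}. -/

import Mathlib

noncomputable section

/-- `Ψ_*(q) = Ψ(q)/|q|` (max norm on `ℤ^n`). -/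
def PsiStar {n : ℕ} (Ψ : (Fin n → ℤ) → ℝ) (q : Fin n → ℤ) : ℝ := Ψ q / ‖q‖

/-- `s(Q,Ψ) = inf {s ≥ 0 : ∑_{q ∈ Q} Ψ_*(q)^s < ∞}`. -/
def sExp {n : ℕ} (Q : Set (Fin n → ℤ)) (Ψ : (Fin n → ℤ) → ℝ) : ℝ :=
  sInf {s : ℝ | 0 ≤ s ∧ Summable fun q : Q => PsiStar Ψ q ^ s}

/-- `Q(M) = {q ∈ Q : M/2 < Ψ_*(q)^{-s} ≤ M}`. -/
def QM {n : ℕ} (Q : Set (Fin n → ℤ)) (Ψ : (Fin n → ℤ) → ℝ) (s M : ℝ) : Set (Fin n → ℤ) :=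
  {q | q ∈ Q ∧ M / 2 < PsiStar Ψ q ^ (-s) ∧ PsiStar Ψ q ^ (-s) ≤ M}

/-- `𝓜 = {2^k : k ∈ ℕ, ∑_{q ∈ Q(2^k)} Ψ_*(q)^s ≥ k^{-(n+1)}}`. -/
def Mcal {n : ℕ} (Q : Set (Fin n → ℤ)) (Ψ : (Fin n → ℤ) → ℝ) (s : ℝ) : Set ℝ :=
  {M | ∃ k : ℕ, M = 2 ^ k ∧
    (((k : ℝ) ^ (n + 1))⁻¹ : ℝ) ≤ ∑' q : QM Q Ψ s (2 ^ k), PsiStar Ψ q ^ s}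

end
/-- The set of divisors `D(ℓ) = {q ∈ ℤ^n : ∃ k ∈ ℤ^m, ℓ_{ij} = k_i q_j for all i,j}` of
`ℓ ∈ ℤ^{mn}` (identified with an `m × n` integer matrix). -/
def Dset (m n : ℕ) (l : Fin m × Fin n → ℤ) : Set (Fin n → ℤ) :=
  {q | ∃ k : Fin m → ℤ, ∀ i j, l (i, j) = k i * q j}

/-- `L(M) = {ℓ ∈ ℤ^{mn} : 0 < |ℓ| ≤ (M/(2 (log₂ M)^{n+1}))^{1/(2mn)}}`. -/
noncomputable def LM (m n : ℕ) (M : ℝ) : Set (Fin m × Fin n → ℤ) :=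
  {l | l ≠ 0 ∧ ‖l‖ ≤ (M / (2 * Real.logb 2 M ^ (n + 1))) ^ ((1 : ℝ) / (2 * m * n))}

/-- `Q'(M) = Q(M) \ ⋃_{ℓ ∈ L(M)} D(ℓ)`. -/
noncomputable def QM' {n : ℕ} (m : ℕ) (Q : Set (Fin n → ℤ)) (Ψ : (Fin n → ℤ) → ℝ) (s M : ℝ) :
    Set (Fin n → ℤ) :=
  QM Q Ψ s M \ ⋃ l ∈ LM m n M, Dset m n l
noncomputable section

/-- The Fourier transform on `ℝ^m`: `φ̂(ξ) = ∫ e^{-2πi x·ξ} φ(x) dx`. -/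
def ftRm {m : ℕ} (φ : (Fin m → ℝ) → ℝ) (ξ : Fin m → ℝ) : ℂ :=
  ∫ x : Fin m → ℝ,
    Complex.exp (((-(2 * Real.pi * ∑ i, x i * ξ i) : ℝ) : ℂ) * Complex.I) * (φ x : ℂ)

/-- The `ℤ^m`-periodization `Φ^ε(y) = ∑_{r ∈ ℤ^m} ε^{-m} φ(ε^{-1}(y - r))`. -/
def PhiEps {m : ℕ} (φ : (Fin m → ℝ) → ℝ) (ε : ℝ) (y : Fin m → ℝ) : ℝ :=
  ∑' r : Fin m → ℤ, (ε ^ m)⁻¹ * φ (fun i => (y i - (r i : ℝ)) / ε)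

/-- `Φ^ε_{q,θ}(x) = Φ^ε(xq - θ)` for `x ∈ ℝ^{mn}` identified with an `m × n` matrix. -/
def PhiQ {m n : ℕ} (φ : (Fin m → ℝ) → ℝ) (ε : ℝ) (q : Fin n → ℤ) (θ : Fin m → ℝ)
    (x : Fin m × Fin n → ℝ) : ℝ :=
  PhiEps φ ε (fun i => (∑ j : Fin n, x (i, j) * (q j : ℝ)) - θ i)

/-- The `ℓ`-th Fourier coefficient `∫_{[0,1]^{mn}} f(x) e^{-2πi ℓ·x} dx` of a
`ℤ^{mn}`-periodic function. -/
def fcoef {m n : ℕ} (f : (Fin m × Fin n → ℝ) → ℝ) (l : Fin m × Fin n → ℤ) : ℂ :=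
  ∫ x in {x : Fin m × Fin n → ℝ | ∀ p, x p ∈ Set.Icc (0 : ℝ) 1},
    (f x : ℂ) * Complex.exp (((-(2 * Real.pi * ∑ p, x p * (l p : ℝ)) : ℝ) : ℂ) * Complex.I)

end
/-- `F_M(x) = |Q'|⁻¹ ∑_{q ∈ Q'} Φ^{Ψ(q)}_{q,θ}(x)`. -/
noncomputable def FM {m n : ℕ} (φ : (Fin m → ℝ) → ℝ) (Ψ : (Fin n → ℤ) → ℝ) (θ : Fin m → ℝ)
    (Q' : Set (Fin n → ℤ)) (x : Fin m × Fin n → ℝ) : ℝ :=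
  ((Q'.ncard : ℝ))⁻¹ * ∑' q : Q', PhiQ φ (Ψ q) q θ x

/-- `w_s(t) = exp(s log t / log log t)`. -/
noncomputable def wfun (s t : ℝ) : ℝ := Real.exp (s * Real.log t / Real.log (Real.log t))

/-- `g(ξ) = 1` for `|ξ| ≤ 3` and `g(ξ) = |ξ|^{-s} w₁(|ξ|) (log|ξ|)^{n+1}` for `|ξ| > 3`. -/
noncomputable def gfun (n : ℕ) (s t : ℝ) : ℝ :=
  if t ≤ 3 then 1 else t ^ (-s) * wfun 1 t * Real.log t ^ (n + 1)

/-- The Fourier transform on `ℝ^{mn}`: `f̂(ξ) = ∫ e^{-2πi x·ξ} f(x) dx`. -/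
noncomputable def ftRmn {m n : ℕ} (f : (Fin m × Fin n → ℝ) → ℝ) (ξ : Fin m × Fin n → ℝ) : ℂ :=
  ∫ x : Fin m × Fin n → ℝ,
    Complex.exp (((-(2 * Real.pi * ∑ p, x p * ξ p) : ℝ) : ℂ) * Complex.I) * (f x : ℂ)

open Filter Topology MeasureTheory
open scoped ContDiff

/-- Explicit divisor bound `d(N) ≤ N^δ (1 + 1/(δ log 2))^{2^{1/δ}}`. -/
lemma card_divisors_le_rpow_mul {N : ℕ} (hN : N ≠ 0) {δ : ℝ} (hδ : 0 < δ) :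
    (N.divisors.card : ℝ) ≤
      (N : ℝ) ^ δ * (1 + 1 / (δ * Real.log 2)) ^ ((2 : ℝ) ^ (1 / δ)) := by
  have hl2 : 0 < Real.log 2 := Real.log_pos (by norm_num)
  set B : ℝ := 1 + 1 / (δ * Real.log 2) with hB
  have hB1 : 1 ≤ B := by
    have : 0 < 1 / (δ * Real.log 2) := by positivity
    linarith
  have hfac : ∀ p ∈ N.primeFactors, ((N.factorization p + 1 : ℕ) : ℝ) ≤
      ((p : ℝ) ^ (N.factorization p)) ^ δ * (if (p : ℝ) < 2 ^ (1 / δ) then B else 1) := by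
    intro p hp
    have hp2 : (2 : ℝ) ≤ p := by exact_mod_cast (Nat.prime_of_mem_primeFactors hp).two_le
    have hp0 : (0 : ℝ) < p := by linarith
    set a := N.factorization p
    have hexp : ((p : ℝ) ^ a) ^ δ = Real.exp (a * (δ * Real.log p)) := by
      rw [← Real.rpow_natCast, ← Real.rpow_mul hp0.le, Real.rpow_def_of_pos hp0]
      ring_nf
    rw [hexp]
    push_cast
    split_ifs with h
    · have h1 : 1 + a * (δ * Real.log 2) ≤ Real.exp (a * (δ * Real.log p)) := by
        have := Real.add_one_le_exp (a * (δ * Real.log p))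
        have h3 : a * (δ * Real.log 2) ≤ a * (δ * Real.log p) := by gcongr
        linarith
      calc (a : ℝ) + 1 ≤ (1 + a * (δ * Real.log 2)) * B := by
            rw [hB]
            have : (1 + a * (δ * Real.log 2)) * (1 + 1 / (δ * Real.log 2))
              = 1 + a + a * (δ * Real.log 2) + 1 / (δ * Real.log 2) := by
                field_simp
                ring
            rw [this]
            have : 0 ≤ a * (δ * Real.log 2) + 1 / (δ * Real.log 2) := by positivity
            linarith
        _ ≤ _ := by gcongr
    · push Not at h
      have h1 : Real.log 2 ≤ δ * Real.log p := by
        have := Real.log_le_log (by positivity) h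
        rw [Real.log_rpow (by norm_num)] at this
        rw [div_mul_eq_mul_div, one_mul, div_le_iff₀ hδ] at this
        linarith
      calc (a : ℝ) + 1 ≤ 2 ^ a := by exact_mod_cast Nat.lt_two_pow_self
        _ = Real.exp (a * Real.log 2) := by
            rw [mul_comm, Real.exp_mul, Real.exp_log (by norm_num), Real.rpow_natCast]
        _ ≤ Real.exp (a * (δ * Real.log p)) * 1 := by
            rw [mul_one]
            gcongr
  rw [Nat.card_divisors hN]
  push_cast at hfac ⊢
  refine (Finset.prod_le_prod (fun _ _ => by positivity) hfac).trans ?_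
  rw [Finset.prod_mul_distrib]
  have hprod : ∏ p ∈ N.primeFactors, ((p : ℝ) ^ (N.factorization p)) ^ δ = (N : ℝ) ^ δ := by
    rw [Real.finsetProd_rpow _ _ (fun _ _ => by positivity)]
    congr 1
    conv_rhs => rw [← Nat.prod_factorization_pow_eq_self hN]
    rw [Finsupp.prod]
    push_cast
    rfl
  rw [hprod]
  gcongr
  rw [Finset.prod_ite, Finset.prod_const_one, mul_one, Finset.prod_const, ← Real.rpow_natCast]
  refine Real.rpow_le_rpow_of_exponent_le hB1 ?_
  have hsub : (N.primeFactors.filter fun p : ℕ => (p : ℝ) < 2 ^ (1 / δ)) ⊆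
      Finset.Icc 1 ⌊(2 : ℝ) ^ (1 / δ)⌋₊ := by
    intro p hp
    rw [Finset.mem_filter] at hp
    exact Finset.mem_Icc.2 ⟨(Nat.prime_of_mem_primeFactors hp.1).one_le, Nat.le_floor hp.2.le⟩
  calc _ ≤ ((Finset.Icc 1 ⌊(2 : ℝ) ^ (1 / δ)⌋₊).card : ℝ) := by
        exact_mod_cast Finset.card_le_card hsub
    _ ≤ _ := by
        rw [Nat.card_Icc, Nat.add_sub_cancel]
        exact Nat.floor_le (by positivity)

/-- The number of divisors of integers up to `t` is `o(w₁(t))`. -/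
lemma eventually_card_divisors_le_wfun {η : ℝ} (hη : 0 < η) :
    ∀ᶠ t : ℝ in atTop, ∀ N : ℕ, N ≠ 0 → (N : ℝ) ≤ t →
      2 * (N.divisors.card : ℝ) ≤ η * wfun 1 t := by
  have hl2 : 0 < Real.log 2 := Real.log_pos (by norm_num)
  have hl2' : Real.log 2 < 3 / 4 := by linarith [Real.log_two_lt_d9]
  set b : ℝ := 1 - 4 / 3 * Real.log 2 with hb
  have hb0 : 0 < b := by rw [hb]; linarith
  have key : Tendsto (fun v : ℝ => Real.exp v / v *
      (1 / 4 - 4 / (3 * Real.log 2) * (v ^ 2 * Real.exp (-b * v)))) atTop atTop := by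
    refine Tendsto.atTop_mul_pos (C := 1 / 4) (by norm_num) ?_ ?_
    · simpa using Real.tendsto_exp_div_pow_atTop 1
    · have h := Real.tendsto_pow_mul_exp_neg_atTop_nhds_zero 2
      have h2 : Tendsto (fun v : ℝ => v ^ 2 * Real.exp (-b * v)) atTop (𝓝 0) := by
        have h3 := (h.comp (tendsto_id.const_mul_atTop hb0)).const_mul ((b ^ 2)⁻¹)
        rw [mul_zero] at h3
        refine h3.congr fun v => ?_
        simp only [Function.comp, id, neg_mul]
        field_simp
      simpa using (tendsto_const_nhds (x := (1 / 4 : ℝ))).sub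
        (h2.const_mul (4 / (3 * Real.log 2)))
  have hll : Tendsto (fun t : ℝ => Real.log (Real.log t)) atTop atTop :=
    Real.tendsto_log_atTop.comp Real.tendsto_log_atTop
  filter_upwards [hll.eventually (key.eventually_ge_atTop (Real.log 2 - Real.log η)),
    hll.eventually_gt_atTop 0, Real.tendsto_log_atTop.eventually_gt_atTop 0,
    eventually_gt_atTop 0] with t h1 hv hu ht N hN hNt
  set v := Real.log (Real.log t) with hvdef
  have hu' : Real.log t = Real.exp v := by rw [hvdef, Real.exp_log hu]
  have hδ : 0 < 3 / 4 / v := by positivity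
  have hdiv := card_divisors_le_rpow_mul hN hδ
  have hpow : (N : ℝ) ^ (3 / 4 / v) ≤ Real.exp (3 / 4 * (Real.exp v / v)) := by
    calc (N : ℝ) ^ (3 / 4 / v) ≤ t ^ (3 / 4 / v) := by gcongr
      _ = _ := by
        rw [Real.rpow_def_of_pos ht, hu']
        congr 1
        ring
  have h2 : (2 : ℝ) ^ (1 / (3 / 4 / v)) = Real.exp (v * (1 - b)) := by
    rw [Real.rpow_def_of_pos (by norm_num), hb]
    congr 1
    field_simp
    ring
  have hBle : (1 + 1 / (3 / 4 / v * Real.log 2)) ^ ((2 : ℝ) ^ (1 / (3 / 4 / v))) ≤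
      Real.exp (4 / (3 * Real.log 2) * v * Real.exp (v * (1 - b))) := by
    rw [h2, Real.exp_mul (4 / (3 * Real.log 2) * v)]
    refine Real.rpow_le_rpow (by positivity) ?_ (Real.exp_pos _).le
    have := Real.add_one_le_exp (4 / (3 * Real.log 2) * v)
    refine le_trans (le_of_eq ?_) this
    field_simp
    ring
  have hw : η * wfun 1 t = Real.exp (Real.log η + Real.exp v / v) := by
    rw [Real.exp_add, Real.exp_log hη, wfun, ← hvdef, hu', one_mul]
  rw [hw]
  calc 2 * (N.divisors.card : ℝ)
      ≤ 2 * (Real.exp (3 / 4 * (Real.exp v / v)) *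
        Real.exp (4 / (3 * Real.log 2) * v * Real.exp (v * (1 - b)))) := by
        gcongr
        exact hdiv.trans (by gcongr)
    _ = Real.exp (Real.log 2 + (3 / 4 * (Real.exp v / v) +
        4 / (3 * Real.log 2) * v * Real.exp (v * (1 - b)))) := by
        rw [Real.exp_add, Real.exp_add, Real.exp_log (by norm_num : (0 : ℝ) < 2)]
    _ ≤ _ := by
        refine Real.exp_le_exp.2 ?_
        have h3 : Real.exp v / v * (1 / 4 - 4 / (3 * Real.log 2) * (v ^ 2 * Real.exp (-b * v)))
            = 1 / 4 * (Real.exp v / v) - 4 / (3 * Real.log 2) * v * Real.exp (v * (1 - b)) := by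
          rw [show v * (1 - b) = v + -b * v by ring, Real.exp_add]
          field_simp
        linarith

/-- Divisors of a nonzero matrix inject, up to sign, into the divisors of a nonzero entry. -/
lemma Dset_finite_ncard_le {m n : ℕ} {l : Fin m × Fin n → ℤ} {p : Fin m × Fin n} (hp : l p ≠ 0) :
    (Dset m n l).Finite ∧ (Dset m n l).ncard ≤ 2 * (l p).natAbs.divisors.card := by
  obtain ⟨i, j⟩ := p
  set D : Finset ℕ := (l (i, j)).natAbs.divisors
  set E : Finset ℤ := D.image (fun d : ℕ => (d : ℤ)) ∪ D.image (fun d : ℕ => -(d : ℤ))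
  have hE : E.card ≤ 2 * D.card := by
    refine (Finset.card_union_le _ _).trans ?_
    have h1 := Finset.card_image_le (s := D) (f := fun d : ℕ => (d : ℤ))
    have h2 := Finset.card_image_le (s := D) (f := fun d : ℕ => -(d : ℤ))
    omega
  have hsub : Dset m n l ⊆ (E.image fun k : ℤ => fun j' => l (i, j') / k : Finset (Fin n → ℤ)) := by
    rintro q ⟨k, hk⟩
    have hki : k i ≠ 0 := by
      intro h
      exact hp (by rw [hk, h, zero_mul])
    rw [Finset.coe_image]
    refine ⟨k i, ?_, ?_⟩
    · have hD : (k i).natAbs ∈ D :=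
        Nat.mem_divisors.2 ⟨Int.natAbs_dvd_natAbs.2 ⟨q j, hk i j⟩, Int.natAbs_ne_zero.2 hp⟩
      rw [Finset.mem_coe, Finset.mem_union, Finset.mem_image, Finset.mem_image]
      rcases Int.natAbs_eq (k i) with h | h
      · exact Or.inl ⟨_, hD, h.symm⟩
      · exact Or.inr ⟨_, hD, h.symm⟩
    · funext j'
      simp only [hk i j']
      exact Int.mul_ediv_cancel_left _ hki
  refine ⟨(Finset.finite_toSet _).subset hsub, ?_⟩
  calc (Dset m n l).ncard ≤ _ := Set.ncard_le_ncard hsub (Finset.finite_toSet _)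
    _ ≤ _ := by
      rw [Set.ncard_coe_finset]
      exact Finset.card_image_le.trans hE

lemma natCast_natAbs_le_norm {ι : Type*} [Fintype ι] (l : ι → ℤ) (p : ι) :
    ((l p).natAbs : ℝ) ≤ ‖l‖ := by
  refine le_trans (le_of_eq ?_) (norm_le_pi_norm l p)
  rw [Int.norm_eq_abs, Nat.cast_natAbs, Int.cast_abs]

/-- `|D(ℓ)| = o(w₁(|ℓ|))`. -/
lemma eventually_ncard_Dset_le (m n : ℕ) {η : ℝ} (hη : 0 < η) :
    ∀ᶠ t : ℝ in atTop, ∀ l : Fin m × Fin n → ℤ, l ≠ 0 → ‖l‖ = t →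
      ((Dset m n l).ncard : ℝ) ≤ η * wfun 1 t := by
  filter_upwards [eventually_card_divisors_le_wfun hη] with t ht l hl hlt
  obtain ⟨p, hp⟩ := Function.ne_iff.1 hl
  calc ((Dset m n l).ncard : ℝ) ≤ 2 * (l p).natAbs.divisors.card := by
        exact_mod_cast (Dset_finite_ncard_le hp).2
    _ ≤ _ := ht _ (Int.natAbs_ne_zero.2 hp) (hlt ▸ natCast_natAbs_le_norm l p)

/-- `|D(ℓ)| ≪ |ℓ|^{1/2}`. -/
lemma exists_ncard_Dset_le_sqrt (m n : ℕ) :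
    ∃ A : ℝ, 0 < A ∧ ∀ l : Fin m × Fin n → ℤ, l ≠ 0 →
      ((Dset m n l).ncard : ℝ) ≤ A * ‖l‖ ^ (1 / 2 : ℝ) := by
  have hl2 : 0 < Real.log 2 := Real.log_pos (by norm_num)
  refine ⟨2 * (1 + 1 / (1 / 2 * Real.log 2)) ^ ((2 : ℝ) ^ (1 / (1 / 2 : ℝ))), by positivity, ?_⟩
  intro l hl
  obtain ⟨p, hp⟩ := Function.ne_iff.1 hl
  calc ((Dset m n l).ncard : ℝ) ≤ 2 * (l p).natAbs.divisors.card := by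
        exact_mod_cast (Dset_finite_ncard_le hp).2
    _ ≤ 2 * (((l p).natAbs : ℝ) ^ (1 / 2 : ℝ) *
          (1 + 1 / (1 / 2 * Real.log 2)) ^ ((2 : ℝ) ^ (1 / (1 / 2 : ℝ)))) := by
        gcongr
        exact card_divisors_le_rpow_mul (Int.natAbs_ne_zero.2 hp) (by norm_num)
    _ ≤ 2 * (‖l‖ ^ (1 / 2 : ℝ) *
          (1 + 1 / (1 / 2 * Real.log 2)) ^ ((2 : ℝ) ^ (1 / (1 / 2 : ℝ)))) := by
        gcongr
        exact natCast_natAbs_le_norm l p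
    _ = _ := by ring

section FourierPi
variable {ι : Type*}

/-- The integer point `l`, as a real vector. -/
def intVec (l : ι → ℤ) : ι → ℝ := fun i => (l i : ℝ)

lemma intVec_add (k l : ι → ℤ) : intVec (k + l) = intVec k + intVec l := by
  funext i; simp [intVec]

lemma intVec_neg (l : ι → ℤ) : intVec (-l) = -intVec l := by
  funext i; simp [intVec]

lemma intVec_sub (k l : ι → ℤ) : intVec (k - l) = intVec k - intVec l := by
  funext i; simp [intVec]

variable [Fintype ι]

/-- The character `x ↦ e^{-2πi x·ξ}` of `ℝ^ι`. -/
noncomputable def eDot (x ξ : ι → ℝ) : ℂ :=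
  Complex.exp (((-(2 * Real.pi * ∑ i, x i * ξ i) : ℝ) : ℂ) * Complex.I)

/-- The Fourier transform on `ℝ^ι`. -/
noncomputable def ftPi (f : (ι → ℝ) → ℂ) (ξ : ι → ℝ) : ℂ := ∫ x, eDot x ξ * f x

lemma norm_intVec (l : ι → ℤ) : ‖intVec l‖ = ‖l‖ := by
  simp only [Pi.norm_def, intVec]
  congr 2

lemma norm_eDot (x ξ : ι → ℝ) : ‖eDot x ξ‖ = 1 := Complex.norm_exp_ofReal_mul_I _

lemma eDot_add_left (x y ξ : ι → ℝ) : eDot (x + y) ξ = eDot x ξ * eDot y ξ := by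
  rw [eDot, eDot, eDot, ← Complex.exp_add, ← add_mul, ← Complex.ofReal_add]
  congr 4
  simp only [Pi.add_apply, add_mul, Finset.sum_add_distrib]
  ring

lemma eDot_comm (x ξ : ι → ℝ) : eDot x ξ = eDot ξ x := by
  simp only [eDot, mul_comm]

lemma eDot_add_right (x ξ ζ : ι → ℝ) : eDot x (ξ + ζ) = eDot x ξ * eDot x ζ := by
  rw [eDot_comm, eDot_add_left, eDot_comm ξ, eDot_comm ζ]

lemma eDot_neg_neg (x ξ : ι → ℝ) : eDot (-x) (-ξ) = eDot x ξ := by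
  simp [eDot]

lemma eDot_zero_right (x : ι → ℝ) : eDot x 0 = 1 := by simp [eDot]

lemma eDot_smul_left (c : ℝ) (x ξ : ι → ℝ) : eDot (c • x) ξ = eDot x (c • ξ) := by
  simp only [eDot, Pi.smul_apply, smul_eq_mul]
  congr 5
  refine Finset.sum_congr rfl fun i _ => by ring

lemma eDot_intVec_intVec (k l : ι → ℤ) : eDot (intVec k) (intVec l) = 1 := by
  rw [eDot, Complex.exp_eq_one_iff]
  refine ⟨-∑ i, k i * l i, ?_⟩
  simp only [intVec]
  push_cast
  ring

lemma continuous_eDot (ξ : ι → ℝ) : Continuous fun x => eDot x ξ := by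
  unfold eDot
  fun_prop

lemma norm_ftPi_le (f : (ι → ℝ) → ℂ) (ξ : ι → ℝ) : ‖ftPi f ξ‖ ≤ ∫ x, ‖f x‖ := by
  refine (norm_integral_le_integral_norm _).trans (le_of_eq ?_)
  simp [norm_eDot]

/-- The pairing `(x, ξ) ↦ ∑ xᵢ ξᵢ` as a continuous bilinear map. -/
noncomputable def dotCLM (ι : Type*) [Fintype ι] : (ι → ℝ) →L[ℝ] (ι → ℝ) →L[ℝ] ℝ :=
  LinearMap.toContinuousLinearMap
    ((LinearMap.toContinuousLinearMap : ((ι → ℝ) →ₗ[ℝ] ℝ) ≃ₗ[ℝ] _).toLinearMap ∘ₗ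
      (LinearMap.mk₂ ℝ (fun x ξ : ι → ℝ => ∑ i, x i * ξ i)
      (by intro a b c; simp [add_mul, Finset.sum_add_distrib])
      (by intro a b c; simp [mul_assoc, Finset.mul_sum])
      (by intro a b c; simp [mul_add, Finset.sum_add_distrib])
      (by intro a b c; simp [mul_left_comm, Finset.mul_sum])))

lemma dotCLM_apply (x ξ : ι → ℝ) : dotCLM ι x ξ = ∑ i, x i * ξ i := rfl

lemma fourierIntegral_dotCLM (f : (ι → ℝ) → ℂ) :
    VectorFourier.fourierIntegral Real.fourierChar volume (dotCLM ι).toLinearMap₁₂ f = ftPi f := by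
  funext ξ
  simp only [VectorFourier.fourierIntegral, ftPi]
  congr 1
  funext x
  rw [Circle.smul_def, Real.fourierChar_apply, smul_eq_mul, eDot]
  congr 4
  change 2 * Real.pi * (-(dotCLM ι x ξ)) = _
  rw [dotCLM_apply]
  ring

/-- Fourier decay of compactly supported `C^K` functions. -/
lemma exists_norm_ftPi_le {K : ℕ} {f : (ι → ℝ) → ℝ} (hf : ContDiff ℝ K f)
    (hc : HasCompactSupport f) :
    ∃ A : ℝ, 0 < A ∧ ∀ ξ, ‖ftPi (fun x => (f x : ℂ)) ξ‖ ≤ A * (1 + ‖ξ‖) ^ (-(K : ℝ)) := by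
  classical
  set F : (ι → ℝ) → ℂ := fun x => (f x : ℂ) with hF
  have hFd : ContDiff ℝ ((K : ℕ∞) : WithTop ℕ∞) F :=
    Complex.ofRealCLM.contDiff.comp hf
  have hFc : HasCompactSupport F := hc.comp_left Complex.ofReal_zero
  have hint : ∀ (k n : ℕ), (k : ℕ∞) ≤ 0 → (n : ℕ∞) ≤ K →
      Integrable (fun v ↦ ‖v‖ ^ k * ‖iteratedFDeriv ℝ n F v‖) (volume : Measure (ι → ℝ)) := by
    intro k n _ hn
    refine Continuous.integrable_of_hasCompactSupport ?_ ?_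
    · exact (continuous_norm.pow k).mul (hFd.continuous_iteratedFDeriv (by exact_mod_cast hn)).norm
    · exact ((hFc.iteratedFDeriv n).norm).mul_left
  have hbound : ∀ n : ℕ, n ≤ K → ∃ A : ℝ, 0 ≤ A ∧ ∀ ξ, ‖ξ‖ ^ n * ‖ftPi F ξ‖ ≤ A := by
    intro n hn
    refine ⟨max 0 ((∑ p ∈ Finset.range (0 + 1) ×ˢ Finset.range (n + 1),
          ∫ v, ‖v‖ ^ p.1 * ‖iteratedFDeriv ℝ p.2 F v‖) * 2 ^ n) + ∫ x, ‖F x‖, by positivity, ?_⟩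
    intro ξ
    rcases isEmpty_or_nonempty ι with hι | hι
    · have h0 : ‖ξ‖ = 0 := by rw [Subsingleton.elim ξ 0, norm_zero]
      have : ‖ξ‖ ^ n ≤ 1 := by rw [h0]; exact pow_le_one₀ le_rfl zero_le_one
      have h2 := norm_ftPi_le F ξ
      have h3 : ‖ξ‖ ^ n * ‖ftPi F ξ‖ ≤ 1 * ‖ftPi F ξ‖ := by gcongr
      have := le_max_left 0 ((∑ p ∈ Finset.range (0 + 1) ×ˢ Finset.range (n + 1),
          ∫ v, ‖v‖ ^ p.1 * ‖iteratedFDeriv ℝ p.2 F v‖) * 2 ^ n)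
      linarith
    · obtain ⟨i, hi'⟩ := Finite.exists_max fun i => ‖ξ i‖
      have hi : ‖ξ i‖ = ‖ξ‖ :=
        le_antisymm (norm_le_pi_norm ξ i) ((pi_norm_le_iff_of_nonempty ξ).2 hi')
      have h := VectorFourier.pow_mul_norm_iteratedFDeriv_fourierIntegral_le (dotCLM ι)
        (μ := volume) hFd hint (k := 0) (n := n) le_rfl (by exact_mod_cast hn) (Pi.single i 1) ξ
      rw [norm_iteratedFDeriv_zero, fourierIntegral_dotCLM, dotCLM_apply] at h
      simp only [Pi.single_apply, ite_mul, one_mul, zero_mul, Finset.sum_ite_eq',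
        Finset.mem_univ, if_true, pow_zero, mul_one, Nat.cast_zero, mul_zero, zero_add] at h
      rw [← Real.norm_eq_abs, hi] at h
      have hs : ‖(Pi.single i 1 : ι → ℝ)‖ = 1 := by rw [Pi.norm_single, norm_one]
      rw [hs, one_pow, one_mul] at h
      refine h.trans ?_
      have h1 : 0 ≤ ∫ x, ‖F x‖ := by positivity
      refine le_trans ?_ (le_add_of_nonneg_right h1)
      refine le_trans (le_of_eq ?_) (le_max_right _ _)
      simp only [zero_add]
      ring
  obtain ⟨A₀, hA₀, h₀⟩ := hbound 0 (Nat.zero_le _)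
  obtain ⟨A₁, hA₁, h₁⟩ := hbound K le_rfl
  refine ⟨2 ^ K * (A₀ + A₁) + 1, by positivity, fun ξ => ?_⟩
  have hpos : 0 < 1 + ‖ξ‖ := by positivity
  rw [Real.rpow_neg hpos.le, Real.rpow_natCast, ← div_eq_mul_inv, le_div_iff₀ (by positivity)]
  have h2 : (1 + ‖ξ‖) ^ K ≤ 2 ^ K * (1 + ‖ξ‖ ^ K) := by
    calc (1 + ‖ξ‖) ^ K ≤ 2 ^ (K - 1) * (1 ^ K + ‖ξ‖ ^ K) :=
          add_pow_le (by norm_num) (norm_nonneg _) K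
      _ ≤ _ := by
        rw [one_pow]
        gcongr
        · norm_num
        · omega
  have h00 := h₀ ξ
  rw [pow_zero, one_mul] at h00
  calc ‖ftPi F ξ‖ * (1 + ‖ξ‖) ^ K ≤ ‖ftPi F ξ‖ * (2 ^ K * (1 + ‖ξ‖ ^ K)) := by gcongr
    _ = 2 ^ K * (‖ftPi F ξ‖ + ‖ξ‖ ^ K * ‖ftPi F ξ‖) := by ring
    _ ≤ 2 ^ K * (A₀ + A₁) := by gcongr; exact h₁ ξ
    _ ≤ _ := by linarith

lemma summable_one_add_norm_rpow {a : ℝ} (ha : (Fintype.card ι : ℝ) < a) :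
    Summable fun l : ι → ℤ => (1 + ‖l‖) ^ (-a) := by
  classical
  set L : Submodule ℤ (ι → ℝ) := Submodule.span ℤ (Set.range (Pi.basisFun ℝ ι)) with hL
  have hmem : ∀ l : ι → ℤ, intVec l ∈ L := by
    intro l
    rw [Module.Basis.mem_span_iff_repr_mem]
    intro i
    exact ⟨l i, by simp [intVec]⟩
  have hrank : Module.finrank ℤ L = Fintype.card ι := by
    rw [ZLattice.rank ℝ, Module.finrank_fintype_fun_eq_card]
  have h := ZLattice.summable_norm_rpow L (-a) (by rw [hrank]; linarith)
  have hinj : Function.Injective fun l : ι → ℤ => (⟨intVec l, hmem l⟩ : L) := by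
    intro k l hkl
    funext i
    have := congrFun (congrArg Subtype.val hkl) i
    simpa [intVec] using this
  have h2 := h.comp_injective hinj
  refine h2.of_norm_bounded_eventually ?_
  have hfin : ({0} : Set (ι → ℤ)).Finite := Set.finite_singleton 0
  filter_upwards [hfin.compl_mem_cofinite] with l hl
  have hl0 : 0 < ‖l‖ := norm_pos_iff.2 hl
  rw [Real.norm_of_nonneg (by positivity)]
  simp only [Function.comp, Submodule.coe_norm, norm_intVec]
  exact Real.rpow_le_rpow_of_nonpos hl0 (by linarith)
    (by have : (0 : ℝ) ≤ Fintype.card ι := by positivity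
        linarith)

/-- Uniform bound for lattice sums of `(1 + |ξ - ℓ|)^{-a}`. -/
lemma exists_tsum_one_add_norm_sub_le {a : ℝ} (ha : (Fintype.card ι : ℝ) < a) :
    ∃ A : ℝ, 0 < A ∧ ∀ ξ : ι → ℝ, Summable (fun l : ι → ℤ => (1 + ‖ξ - intVec l‖) ^ (-a)) ∧
      ∑' l : ι → ℤ, (1 + ‖ξ - intVec l‖) ^ (-a) ≤ A := by
  have ha0 : 0 < a := lt_of_le_of_lt (by positivity) ha
  have hS := summable_one_add_norm_rpow (ι := ι) ha
  refine ⟨2 ^ a * (∑' l : ι → ℤ, (1 + ‖l‖) ^ (-a)) + 1, ?_, fun ξ => ?_⟩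
  · have : 0 ≤ ∑' l : ι → ℤ, (1 + ‖l‖) ^ (-a) := tsum_nonneg fun l => by positivity
    positivity
  set r : ι → ℤ := fun i => ⌊ξ i⌋ with hr
  have hξr : ‖ξ - intVec r‖ ≤ 1 := by
    refine (pi_norm_le_iff_of_nonneg zero_le_one).2 fun i => ?_
    simp only [Pi.sub_apply, intVec, hr, Real.norm_eq_abs]
    rw [abs_of_nonneg (by linarith [Int.floor_le (ξ i)])]
    linarith [Int.lt_floor_add_one (ξ i)]
  have hle : ∀ l : ι → ℤ, (1 + ‖ξ - intVec l‖) ^ (-a) ≤ 2 ^ a * (1 + ‖r - l‖) ^ (-a) := by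
    intro l
    have h1 : ‖r - l‖ ≤ 1 + ‖ξ - intVec l‖ := by
      rw [← norm_intVec, intVec_sub]
      calc ‖intVec r - intVec l‖ = ‖(ξ - intVec l) - (ξ - intVec r)‖ := by congr 1; abel
        _ ≤ ‖ξ - intVec l‖ + ‖ξ - intVec r‖ := norm_sub_le _ _
        _ ≤ _ := by linarith
    have h2 : (1 + ‖r - l‖) / 2 ≤ 1 + ‖ξ - intVec l‖ := by
      linarith [norm_nonneg (ξ - intVec l)]
    calc (1 + ‖ξ - intVec l‖) ^ (-a) ≤ ((1 + ‖r - l‖) / 2) ^ (-a) :=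
          Real.rpow_le_rpow_of_nonpos (by positivity) h2 (by linarith)
      _ = _ := by
          rw [Real.div_rpow (by positivity) (by norm_num), Real.rpow_neg (by norm_num : (0:ℝ) ≤ 2)]
          field_simp
  have hS' : Summable fun l : ι → ℤ => (1 + ‖r - l‖) ^ (-a) :=
    (Equiv.subLeft r).summable_iff.2 hS
  have hT : ∑' l : ι → ℤ, (1 + ‖r - l‖) ^ (-a) = ∑' l : ι → ℤ, (1 + ‖l‖) ^ (-a) :=
    (Equiv.subLeft r).tsum_eq fun l : ι → ℤ => (1 + ‖l‖) ^ (-a)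
  have hsum := Summable.of_nonneg_of_le (fun l => by positivity) hle (hS'.mul_left (2 ^ a))
  refine ⟨hsum, ?_⟩
  have := hsum.tsum_le_tsum hle (hS'.mul_left (2 ^ a))
  rw [tsum_mul_left, hT] at this
  linarith

end FourierPi

section Poisson
variable {ι : Type*}

/-- The covering map from `ℝ^ι` to the torus. -/
def toTorus (x : ι → ℝ) : UnitAddTorus ι := fun i => (x i : UnitAddCircle)

lemma isOpenQuotientMap_toTorus : IsOpenQuotientMap (toTorus (ι := ι)) :=
  IsOpenQuotientMap.piMap fun _ => QuotientAddGroup.isOpenQuotientMap_mk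

lemma exists_intVec_of_toTorus_eq {x y : ι → ℝ} (h : toTorus x = toTorus y) :
    ∃ r : ι → ℤ, y = x + intVec r := by
  have h1 : ∀ i, ∃ r : ℤ, y i - x i = r := by
    intro i
    have h2 : ((y i - x i : ℝ) : UnitAddCircle) = 0 := by
      rw [AddCircle.coe_sub, sub_eq_zero]
      exact (congrFun h i).symm
    obtain ⟨r, hr⟩ := (AddCircle.coe_eq_zero_iff 1).1 h2
    exact ⟨r, by rw [← hr]; simp⟩
  choose r hr using h1
  exact ⟨r, by funext i; simp [intVec, ← hr i]⟩

variable [Fintype ι]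

lemma exists_finset_forall_translate_eq_zero {E : Type*} [Zero E] [TopologicalSpace E]
    {g : (ι → ℝ) → E} (hg : HasCompactSupport g) (R : ℝ) :
    ∃ S : Finset (ι → ℤ), ∀ y, ‖y‖ ≤ R → ∀ r ∉ S, g (y + intVec r) = 0 := by
  obtain ⟨B, hB⟩ := hg.isCompact.isBounded.exists_norm_le
  have hfin : (Metric.closedBall (0 : ι → ℤ) (B + R)).Finite :=
    (isCompact_closedBall _ _).finite_of_discrete
  refine ⟨hfin.toFinset, fun y hy r hr => ?_⟩
  by_contra h
  refine hr (hfin.mem_toFinset.2 (mem_closedBall_zero_iff.2 ?_))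
  have h1 := hB _ (subset_tsupport g h)
  calc ‖r‖ = ‖(y + intVec r) - y‖ := by rw [add_sub_cancel_left, norm_intVec]
    _ ≤ _ := (norm_sub_le _ _).trans (add_le_add h1 hy)

/-- The half-open unit cube `(0,1]^ι`. -/
def unitCube (ι : Type*) : Set (ι → ℝ) := {x | ∀ i, x i ∈ Set.Ioc (0 : ℝ) (0 + 1)}

lemma measurableSet_unitCube : MeasurableSet (unitCube ι) :=
  MeasurableSet.univ_pi' fun _ => measurableSet_Ioc

lemma norm_le_one_of_mem_unitCube {y : ι → ℝ} (hy : y ∈ unitCube ι) : ‖y‖ ≤ 1 := by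
  refine (pi_norm_le_iff_of_nonneg zero_le_one).2 fun i => ?_
  have := hy i
  rw [Real.norm_eq_abs, abs_of_nonneg this.1.le]
  linarith [this.2]

/-- Unfolding an integral along the translates of the unit cube. -/
lemma hasSum_integral_unitCube {f : (ι → ℝ) → ℂ} (hf : Integrable f) :
    HasSum (fun r : ι → ℤ => ∫ y in unitCube ι, f (y + intVec r)) (∫ y, f y) := by
  set s : (ι → ℤ) → Set (ι → ℝ) := fun r => (fun y => y + -intVec r) ⁻¹' unitCube ι with hs
  have hmem : ∀ r y, y ∈ s r ↔ ∀ i, ⌈y i⌉ = r i + 1 := by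
    intro r y
    simp only [hs, Set.mem_preimage, unitCube, Set.mem_ofPred_eq, Pi.add_apply, Pi.neg_apply, intVec,
      Set.mem_Ioc, Int.ceil_eq_iff]
    refine forall_congr' fun i => ?_
    push_cast
    constructor <;> rintro ⟨h1, h2⟩ <;> constructor <;> linarith
  have hU : (⋃ r, s r) = Set.univ := by
    refine Set.eq_univ_of_forall fun y => Set.mem_iUnion.2 ⟨fun i => ⌈y i⌉ - 1, ?_⟩
    rw [hmem]
    intro i
    ring
  have hd : Pairwise (Function.onFun Disjoint s) := by
    intro r r' hrr
    refine Set.disjoint_left.2 fun y hy hy' => hrr ?_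
    rw [hmem] at hy hy'
    funext i
    have h1 := hy i
    have h2 := hy' i
    omega
  have hm : ∀ r, MeasurableSet (s r) := fun r =>
    (measurable_id.add_const _) measurableSet_unitCube
  have h := hasSum_integral_iUnion hm hd (f := f) (μ := volume) hf.integrableOn
  rw [hU, setIntegral_univ] at h
  have heq : ∀ r, ∫ y in unitCube ι, f (y + intVec r) = ∫ y in s r, f y := by
    intro r
    have hmp := measurePreserving_add_right (volume : Measure (ι → ℝ)) (-intVec r)
    have := hmp.setIntegral_preimage_emb (measurableEmbedding_addRight _)
      (fun y => f (y + intVec r)) (unitCube ι)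
    rw [← this]
    simp [hs]
  simpa only [heq] using h

lemma mFourier_toTorus (n : ι → ℤ) (x : ι → ℝ) :
    UnitAddTorus.mFourier n (toTorus x) = eDot x (-intVec n) := by
  simp only [UnitAddTorus.mFourier, ContinuousMap.coe_mk, toTorus, fourier_coe_apply, eDot]
  rw [← Complex.exp_sum]
  congr 1
  simp only [intVec, Pi.neg_apply]
  push_cast
  simp only [div_one, mul_neg, Finset.sum_neg_distrib, neg_neg, Finset.mul_sum, Finset.sum_mul]
  exact Finset.sum_congr rfl fun i _ => by ring

lemma continuous_tsum_translates {g : (ι → ℝ) → ℂ} (hg : Continuous g) (hc : HasCompactSupport g) :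
    Continuous fun y => ∑' r : ι → ℤ, g (y + intVec r) := by
  refine continuous_iff_continuousAt.2 fun y => ?_
  obtain ⟨S, hS⟩ := exists_finset_forall_translate_eq_zero hc (‖y‖ + 1)
  have hev : (fun y => ∑ r ∈ S, g (y + intVec r)) =ᶠ[𝓝 y]
      fun y => ∑' r : ι → ℤ, g (y + intVec r) := by
    filter_upwards [continuous_norm.continuousAt.eventually_lt continuousAt_const
      (lt_add_one ‖y‖)] with z hz
    exact (tsum_eq_sum fun r hr => hS z hz.le r hr).symm
  refine ContinuousAt.congr ?_ hev
  fun_prop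

/-- Poisson summation for continuous compactly supported functions whose Fourier transform is
summable over the integer lattice. -/
lemma hasSum_poisson {g : (ι → ℝ) → ℂ} (hg : Continuous g) (hc : HasCompactSupport g)
    (hs : Summable fun k : ι → ℤ => ftPi g (intVec k)) (y : ι → ℝ) :
    HasSum (fun k : ι → ℤ => ftPi g (intVec k) * eDot y (-intVec k))
      (∑' r : ι → ℤ, g (y + intVec r)) := by
  set G : C(ι → ℝ, ℂ) := ⟨_, continuous_tsum_translates hg hc⟩ with hG
  have hper : ∀ a b, toTorus a = toTorus b → G a = G b := by
    intro a b hab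
    obtain ⟨r, rfl⟩ := exists_intVec_of_toTorus_eq hab
    simp only [hG, ContinuousMap.coe_mk]
    rw [← (Equiv.addLeft r).tsum_eq]
    refine tsum_congr fun k => ?_
    rw [Equiv.coe_addLeft, intVec_add, add_assoc]
  set F : C(UnitAddTorus ι, ℂ) :=
    (isOpenQuotientMap_toTorus (ι := ι)).isQuotientMap.lift (f := ⟨toTorus,
      isOpenQuotientMap_toTorus.continuous⟩) G hper with hF
  have hFG : ∀ x, F (toTorus x) = G x := fun x =>
    congrFun (congrArg DFunLike.coe
      ((isOpenQuotientMap_toTorus (ι := ι)).isQuotientMap.lift_comp (f := ⟨toTorus,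
      isOpenQuotientMap_toTorus.continuous⟩) G hper)) x
  have hcoef : ∀ k, UnitAddTorus.mFourierCoeff F k = ftPi g (intVec k) := by
    intro k
    rw [UnitAddTorus.mFourierCoeff_eq_integral F k 0]
    change ∫ x in unitCube ι, UnitAddTorus.mFourier (-k) (toTorus x) • F (toTorus x) = _
    have hint : Integrable fun x => eDot x (intVec k) * g x :=
      ((continuous_eDot _).mul hg).integrable_of_hasCompactSupport hc.mul_left
    have h := hasSum_integral_unitCube hint
    obtain ⟨S, hS⟩ := exists_finset_forall_translate_eq_zero hc 1
    rw [ftPi, ← h.tsum_eq, tsum_eq_sum (s := S), ← integral_finsetSum]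
    · refine setIntegral_congr_fun measurableSet_unitCube fun x hx => ?_
      simp only [hFG, mFourier_toTorus, hG, ContinuousMap.coe_mk, smul_eq_mul]
      rw [tsum_eq_sum (s := S) fun r hr => hS x (norm_le_one_of_mem_unitCube hx) r hr,
        Finset.mul_sum]
      refine Finset.sum_congr rfl fun r _ => ?_
      rw [eDot_add_left, eDot_intVec_intVec, mul_one, intVec_neg, neg_neg]
    · intro r _
      exact (hint.comp_add_right _).integrableOn
    · intro r hr
      rw [← integral_zero (α := ι → ℝ) (G := ℂ) (μ := volume.restrict (unitCube ι))]
      refine setIntegral_congr_fun measurableSet_unitCube fun x hx => ?_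
      simp only [hS x (norm_le_one_of_mem_unitCube hx) r hr, mul_zero]
  have hFs : Summable (UnitAddTorus.mFourierCoeff F) := by
    rw [show UnitAddTorus.mFourierCoeff (F : UnitAddTorus ι → ℂ) =
      fun k => ftPi g (intVec k) from funext hcoef]
    exact hs
  have := UnitAddTorus.hasSum_mFourier_series_apply_of_summable hFs (toTorus y)
  simpa only [hcoef, mFourier_toTorus, smul_eq_mul, hFG, hG, ContinuousMap.coe_mk] using this

end Poisson

section Periodization
variable {m : ℕ}

/-- The rescaling `ε^{-m} φ(·/ε)`. -/
noncomputable def rescale (φ : (Fin m → ℝ) → ℝ) (ε : ℝ) (y : Fin m → ℝ) : ℝ :=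
  (ε ^ m)⁻¹ * φ (ε⁻¹ • y)

lemma PhiEps_eq_tsum_rescale (φ : (Fin m → ℝ) → ℝ) (ε : ℝ) (y : Fin m → ℝ) :
    PhiEps φ ε y = ∑' r : Fin m → ℤ, rescale φ ε (y + intVec r) := by
  rw [PhiEps, ← (Equiv.neg (Fin m → ℤ)).tsum_eq]
  refine tsum_congr fun r => ?_
  rw [rescale]
  congr 2
  funext i
  simp [intVec, div_eq_inv_mul]

lemma integrable_rescale {φ : (Fin m → ℝ) → ℝ} (hφ : Integrable φ) {ε : ℝ} (hε : 0 < ε) :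
    Integrable (rescale φ ε) :=
  (hφ.comp_smul (inv_ne_zero hε.ne')).const_mul _

lemma hasCompactSupport_rescale {φ : (Fin m → ℝ) → ℝ} (hφ : HasCompactSupport φ) {ε : ℝ}
    (hε : 0 < ε) : HasCompactSupport (rescale φ ε) :=
  (hφ.comp_smul (inv_ne_zero hε.ne')).mul_left

lemma ftPi_rescale (φ : (Fin m → ℝ) → ℝ) {ε : ℝ} (hε : 0 < ε) (ξ : Fin m → ℝ) :
    ftPi (fun y => (rescale φ ε y : ℂ)) ξ = ftPi (fun y => (φ y : ℂ)) (ε • ξ) := by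
  have h := Measure.integral_comp_inv_smul (volume : Measure (Fin m → ℝ))
    (fun y => eDot y (ε • ξ) * (((ε ^ m)⁻¹ * φ y : ℝ) : ℂ)) ε
  have h1 : ftPi (fun y => (rescale φ ε y : ℂ)) ξ =
      ∫ y, eDot (ε⁻¹ • y) (ε • ξ) * (((ε ^ m)⁻¹ * φ (ε⁻¹ • y) : ℝ) : ℂ) := by
    rw [ftPi]
    congr 1
    funext y
    rw [eDot_smul_left, smul_smul, inv_mul_cancel₀ hε.ne', one_smul, rescale]
  rw [h1, h, ftPi, Module.finrank_fin_fun, abs_of_pos (by positivity), ← integral_smul]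
  congr 1
  funext y
  have : (ε : ℂ) ≠ 0 := by exact_mod_cast hε.ne'
  simp only [Complex.real_smul]
  push_cast
  field_simp

/-- The Fourier series of `Φ^ε`. -/
noncomputable def PhiSeries (φ : (Fin m → ℝ) → ℝ) (ε : ℝ) (y : Fin m → ℝ) : ℂ :=
  ∑' k : Fin m → ℤ, ftPi (fun y => (φ y : ℂ)) (ε • intVec k) * eDot y (-intVec k)

lemma continuous_PhiSeries {φ : (Fin m → ℝ) → ℝ} {ε : ℝ}
    (hs : Summable fun k : Fin m → ℤ => ‖ftPi (fun y => (φ y : ℂ)) (ε • intVec k)‖) :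
    Continuous (PhiSeries φ ε) := by
  refine continuous_tsum (fun k => continuous_const.mul (continuous_eDot _)) hs fun k y => ?_
  rw [norm_mul, norm_eDot, mul_one]

lemma locallyIntegrable_PhiEps {φ : (Fin m → ℝ) → ℝ} (hφ : Integrable φ)
    (hc : HasCompactSupport φ) {ε : ℝ} (hε : 0 < ε) :
    LocallyIntegrable fun y => (PhiEps φ ε y : ℂ) := by
  intro x
  obtain ⟨S, hS⟩ := exists_finset_forall_translate_eq_zero (hasCompactSupport_rescale hc hε)
    (‖x‖ + 1)
  refine ⟨Metric.ball x 1, Metric.ball_mem_nhds x one_pos, ?_⟩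
  have hint : Integrable fun y => ((∑ r ∈ S, rescale φ ε (y + intVec r) : ℝ) : ℂ) :=
    (integrable_finsetSum S fun r _ => (integrable_rescale hφ hε).comp_add_right (intVec r)).ofReal
  refine hint.integrableOn.congr_fun (fun y hy => ?_) Metric.isOpen_ball.measurableSet
  have hy' : ‖y‖ ≤ ‖x‖ + 1 := by
    have h1 : ‖y - x‖ < 1 := mem_ball_iff_norm.1 hy
    have h2 := norm_le_norm_add_norm_sub x y
    rw [norm_sub_rev] at h2
    linarith
  simp only [PhiEps_eq_tsum_rescale]
  rw [tsum_eq_sum fun r hr => hS y hy' r hr]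

lemma integral_mul_PhiEps {φ : (Fin m → ℝ) → ℝ} (hφ : Integrable φ)
    (hc : HasCompactSupport φ) {ε : ℝ} (hε : 0 < ε)
    {g : (Fin m → ℝ) → ℂ} (hg : Continuous g) (hgc : HasCompactSupport g) :
    ∫ y, g y * (PhiEps φ ε y : ℂ) =
      ∫ y, (∑' r : Fin m → ℤ, g (y + intVec r)) * (rescale φ ε y : ℂ) := by
  obtain ⟨R, hR⟩ := hgc.isCompact.isBounded.exists_norm_le
  obtain ⟨S, hS⟩ := exists_finset_forall_translate_eq_zero (hasCompactSupport_rescale hc hε) R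
  have hzero : ∀ y, ∀ r ∉ S, g y * (rescale φ ε (y + intVec r) : ℂ) = 0 := by
    intro y r hr
    by_cases hy : g y = 0
    · rw [hy, zero_mul]
    · rw [hS y (hR y (subset_tsupport g hy)) r hr, Complex.ofReal_zero, mul_zero]
  obtain ⟨B, hB⟩ := hg.bounded_above_of_compact_support hgc
  have hψ := (integrable_rescale hφ hε).ofReal (𝕜 := ℂ)
  have hL : ∀ y, g y * (PhiEps φ ε y : ℂ) =
      ∑ r ∈ S, g y * (rescale φ ε (y + intVec r) : ℂ) := by
    intro y
    rw [PhiEps_eq_tsum_rescale, Complex.ofReal_tsum, ← tsum_mul_left]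
    exact tsum_eq_sum fun r hr => hzero y r hr
  have hRt : ∀ y, (∑' r : Fin m → ℤ, g (y + intVec r)) * (rescale φ ε y : ℂ) =
      ∑ r ∈ S, g (y + intVec (-r)) * (rescale φ ε y : ℂ) := by
    intro y
    rw [← tsum_mul_right, ← (Equiv.neg (Fin m → ℤ)).tsum_eq]
    refine tsum_eq_sum fun r hr => ?_
    have := hzero (y + intVec (-r)) r hr
    rwa [add_assoc, ← intVec_add, neg_add_cancel,
      show intVec (0 : Fin m → ℤ) = 0 by funext i; simp [intVec], add_zero] at this
  simp only [hL, hRt]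
  rw [integral_finsetSum, integral_finsetSum]
  · refine Finset.sum_congr rfl fun r _ => ?_
    rw [← integral_add_right_eq_self _ (intVec (-r))]
    congr 1
    funext y
    rw [add_assoc, ← intVec_add, neg_add_cancel,
      show intVec (0 : Fin m → ℤ) = 0 by funext i; simp [intVec], add_zero]
  · intro r _
    exact hψ.bdd_mul (c := B) (hg.comp (continuous_id.add continuous_const)).aestronglyMeasurable
      (Eventually.of_forall fun y => hB _)
  · intro r _
    exact (hψ.comp_add_right (intVec r)).bdd_mul (c := B) hg.aestronglyMeasurable
      (Eventually.of_forall fun y => hB _)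

/-- `Φ^ε` agrees almost everywhere with its Fourier series. -/
lemma ae_PhiEps_eq_PhiSeries {φ : (Fin m → ℝ) → ℝ} (hφ : Integrable φ)
    (hc : HasCompactSupport φ) {ε : ℝ} (hε : 0 < ε)
    (hs : Summable fun k : Fin m → ℤ => ‖ftPi (fun y => (φ y : ℂ)) (ε • intVec k)‖) :
    ∀ᵐ y : Fin m → ℝ, (PhiEps φ ε y : ℂ) = PhiSeries φ ε y := by
  refine ae_eq_of_integral_contDiff_smul_eq (locallyIntegrable_PhiEps hφ hc hε)
    (continuous_PhiSeries hs).locallyIntegrable fun g hg hgc => ?_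
  set G : (Fin m → ℝ) → ℂ := fun y => (g y : ℂ) with hG
  have hGc : Continuous G := Complex.continuous_ofReal.comp hg.continuous
  have hGs : HasCompactSupport G := hgc.comp_left Complex.ofReal_zero
  have hGi : Integrable G := hGc.integrable_of_hasCompactSupport hGs
  have hψ := (integrable_rescale hφ hε).ofReal (𝕜 := ℂ)
  have hGsum : Summable fun k : Fin m → ℤ => ‖ftPi G (intVec k)‖ := by
    obtain ⟨A, hA, h⟩ := exists_norm_ftPi_le (K := m + 1) (hg.of_le (by exact_mod_cast le_top)) hgc
    refine Summable.of_nonneg_of_le (fun _ => norm_nonneg _) (fun k => h (intVec k)) ?_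
    simp only [norm_intVec]
    refine (summable_one_add_norm_rpow ?_).mul_left A
    simp
  simp only [Complex.real_smul]
  change ∫ y, G y * (PhiEps φ ε y : ℂ) = ∫ y, G y * PhiSeries φ ε y
  rw [integral_mul_PhiEps hφ hc hε hGc hGs]
  have h1 : HasSum (fun k : Fin m → ℤ =>
      ∫ y, ftPi G (intVec k) * eDot y (-intVec k) * (rescale φ ε y : ℂ))
      (∫ y, ∑' k : Fin m → ℤ, ftPi G (intVec k) * eDot y (-intVec k) * (rescale φ ε y : ℂ)) := by
    refine hasSum_integral_of_summable_integral_norm (fun k => ?_) ?_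
    · exact hψ.bdd_mul (c := ‖ftPi G (intVec k)‖)
        (continuous_const.mul (continuous_eDot _)).aestronglyMeasurable
        (Eventually.of_forall fun y => by rw [norm_mul, norm_eDot, mul_one])
    · simp only [norm_mul, norm_eDot, mul_one, integral_const_mul]
      exact hGsum.mul_right _
  have h2 : HasSum (fun k : Fin m → ℤ =>
      ∫ y, G y * (ftPi (fun y => (φ y : ℂ)) (ε • intVec k) * eDot y (-intVec k)))
      (∫ y, ∑' k : Fin m → ℤ,
        G y * (ftPi (fun y => (φ y : ℂ)) (ε • intVec k) * eDot y (-intVec k))) := by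
    refine hasSum_integral_of_summable_integral_norm (fun k => ?_) ?_
    · exact hGi.mul_bdd (c := ‖ftPi (fun y => (φ y : ℂ)) (ε • intVec k)‖)
        (continuous_const.mul (continuous_eDot _)).aestronglyMeasurable
        (Eventually.of_forall fun y => by rw [norm_mul, norm_eDot, mul_one])
    · simp only [norm_mul, norm_eDot, mul_one, integral_mul_const]
      exact hs.mul_left _
  simp only [tsum_mul_right, tsum_mul_left] at h1 h2
  have h3 : ∀ y, ∑' k : Fin m → ℤ, ftPi G (intVec k) * eDot y (-intVec k) =
      ∑' r : Fin m → ℤ, G (y + intVec r) := fun y =>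
    (hasSum_poisson hGc hGs hGsum.of_norm y).tsum_eq
  simp only [h3] at h1
  simp only [PhiSeries]
  rw [← h1.tsum_eq, ← h2.tsum_eq, ← (Equiv.neg (Fin m → ℤ)).tsum_eq]
  refine tsum_congr fun k => ?_
  have h4 : ftPi G (intVec (-k)) = ∫ y, eDot y (-intVec k) * G y := by
    rw [intVec_neg, ftPi]
  have h5 : ∫ y, ftPi G (intVec (-k)) * eDot y (intVec k) * (rescale φ ε y : ℂ) =
      ftPi G (intVec (-k)) * ftPi (fun y => (φ y : ℂ)) (ε • intVec k) := by
    have h6 : ftPi (fun y => (rescale φ ε y : ℂ)) (intVec k) =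
        ∫ y, eDot y (intVec k) * (rescale φ ε y : ℂ) := rfl
    rw [← ftPi_rescale φ hε, h6, ← integral_const_mul]
    simp only [mul_assoc]
  rw [Equiv.neg_apply, intVec_neg, neg_neg, ← intVec_neg, h5, h4, ← integral_mul_const]
  congr 1
  funext y
  rw [intVec_neg]
  ring

end Periodization

section PhiQ
variable {m n : ℕ}

/-- The matrix `k ⊗ q`. -/
def tens (k : Fin m → ℤ) (q : Fin n → ℤ) : Fin m × Fin n → ℤ := fun p => k p.1 * q p.2

/-- The linear map `x ↦ xq`. -/
def mulVecInt (m : ℕ) (q : Fin n → ℤ) : (Fin m × Fin n → ℝ) →ₗ[ℝ] (Fin m → ℝ) where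
  toFun x i := ∑ j, x (i, j) * (q j : ℝ)
  map_add' x y := by funext i; simp [add_mul, Finset.sum_add_distrib]
  map_smul' c x := by funext i; simp [mul_assoc, Finset.mul_sum]

lemma mulVecInt_surjective {q : Fin n → ℤ} (hq : q ≠ 0) :
    Function.Surjective (mulVecInt m q) := by
  obtain ⟨j, hj⟩ := Function.ne_iff.1 hq
  have hj' : (q j : ℝ) ≠ 0 := by exact_mod_cast hj
  intro y
  refine ⟨fun p => if p.2 = j then y p.1 / q j else 0, ?_⟩
  funext i
  simp [mulVecInt, hj']

lemma eDot_mulVecInt (x : Fin m × Fin n → ℝ) (k : Fin m → ℤ) (q : Fin n → ℤ) :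
    eDot (mulVecInt m q x) (intVec k) = eDot x (intVec (tens k q)) := by
  simp only [eDot, mulVecInt, LinearMap.coe_mk, AddHom.coe_mk, intVec, tens]
  congr 5
  rw [Fintype.sum_prod_type]
  refine Finset.sum_congr rfl fun i _ => ?_
  rw [Finset.sum_mul]
  refine Finset.sum_congr rfl fun j _ => ?_
  push_cast
  ring

lemma ae_PhiQ_eq_PhiSeries {φ : (Fin m → ℝ) → ℝ} (hφ : Integrable φ)
    (hc : HasCompactSupport φ) {ε : ℝ} (hε : 0 < ε)
    (hs : Summable fun k : Fin m → ℤ => ‖ftPi (fun y => (φ y : ℂ)) (ε • intVec k)‖)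
    {q : Fin n → ℤ} (hq : q ≠ 0) (θ : Fin m → ℝ) :
    ∀ᵐ x : Fin m × Fin n → ℝ,
      (PhiQ φ ε q θ x : ℂ) = PhiSeries φ ε (mulVecInt m q x - θ) := by
  have h := ae_PhiEps_eq_PhiSeries hφ hc hε hs
  have h1 : ∀ᵐ y : Fin m → ℝ, (PhiEps φ ε (y - θ) : ℂ) = PhiSeries φ ε (y - θ) :=
    (measurePreserving_sub_right volume θ).quasiMeasurePreserving.ae h
  obtain ⟨s, hs1, hs2, hs3⟩ := h1.exists_measurable_mem
  have h2 := (ae_comp_linearMap_mem_iff (mulVecInt m q) volume volume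
    (mulVecInt_surjective hq) hs2).2 hs1
  filter_upwards [h2] with x hx
  exact hs3 _ hx

/-- Fourier expansion of `(χ Φ_q)^`. -/
lemma hasSum_ftPi_mul_PhiQ {φ : (Fin m → ℝ) → ℝ} (hφ : Integrable φ)
    (hc : HasCompactSupport φ) {ε : ℝ} (hε : 0 < ε)
    (hs : Summable fun k : Fin m → ℤ => ‖ftPi (fun y => (φ y : ℂ)) (ε • intVec k)‖)
    {q : Fin n → ℤ} (hq : q ≠ 0) (θ : Fin m → ℝ) {χ : (Fin m × Fin n → ℝ) → ℂ}
    (hχ : Integrable χ) (ξ : Fin m × Fin n → ℝ) :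
    Integrable (fun x => χ x * (PhiQ φ ε q θ x : ℂ)) ∧
    HasSum (fun k : Fin m → ℤ => ftPi (fun y => (φ y : ℂ)) (ε • intVec k) *
        eDot θ (intVec k) * ftPi χ (ξ - intVec (tens k q)))
      (ftPi (fun x => χ x * (PhiQ φ ε q θ x : ℂ)) ξ) := by
  have hae := ae_PhiQ_eq_PhiSeries hφ hc hε hs hq θ
  have hcont : Continuous fun x : Fin m × Fin n → ℝ => PhiSeries φ ε (mulVecInt m q x - θ) :=
    (continuous_PhiSeries hs).comp
      ((mulVecInt m q).continuous_of_finiteDimensional.sub continuous_const)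
  set c : (Fin m → ℤ) → ℂ := fun k => ftPi (fun y => (φ y : ℂ)) (ε • intVec k) with hcdef
  constructor
  · have h1 : Integrable fun x => χ x * PhiSeries φ ε (mulVecInt m q x - θ) := by
      refine hχ.mul_bdd (c := ∑' k, ‖c k‖) hcont.aestronglyMeasurable
        (Eventually.of_forall fun x => ?_)
      refine tsum_of_norm_bounded hs.hasSum fun k => ?_
      rw [norm_mul, norm_eDot, mul_one]
    refine h1.congr ?_
    filter_upwards [hae] with x hx
    rw [hx]
  · have h2 : ftPi (fun x => χ x * (PhiQ φ ε q θ x : ℂ)) ξ =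
        ∫ x, ∑' k, c k * eDot θ (intVec k) * (eDot x (ξ - intVec (tens k q)) * χ x) := by
      refine integral_congr_ae ?_
      filter_upwards [hae] with x hx
      rw [hx, PhiSeries, ← tsum_mul_left, ← tsum_mul_left]
      refine tsum_congr fun k => ?_
      rw [sub_eq_add_neg (mulVecInt m q x), eDot_add_left, eDot_neg_neg, ← intVec_neg,
        eDot_mulVecInt, sub_eq_add_neg ξ, eDot_add_right, ← intVec_neg]
      have : tens (-k) q = -tens k q := by funext p; simp [tens]
      rw [this]
      ring
    rw [h2]
    have h3 : ∀ k, c k * eDot θ (intVec k) * ftPi χ (ξ - intVec (tens k q)) =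
        ∫ x, c k * eDot θ (intVec k) * (eDot x (ξ - intVec (tens k q)) * χ x) := fun k => by
      rw [ftPi, ← integral_const_mul]
    change HasSum (fun k => c k * eDot θ (intVec k) * ftPi χ (ξ - intVec (tens k q))) _
    rw [funext h3]
    refine hasSum_integral_of_summable_integral_norm (fun k => ?_) ?_
    · refine Integrable.const_mul ?_ _
      exact hχ.bdd_mul (c := 1) (continuous_eDot _).aestronglyMeasurable
        (Eventually.of_forall fun x => (norm_eDot _ _).le)
    · simp only [norm_mul, norm_eDot, mul_one, one_mul, integral_const_mul]
      exact hs.mul_right _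

end PhiQ

section GEstimates

lemma one_lt_log_of_three_lt {t : ℝ} (ht : 3 < t) : 1 < Real.log t := by
  rw [Real.lt_log_iff_exp_lt (by linarith)]
  linarith [Real.exp_one_lt_d9]

lemma one_le_wfun {t : ℝ} (ht : 3 < t) : 1 ≤ wfun 1 t := by
  have h := one_lt_log_of_three_lt ht
  refine Real.one_le_exp ?_
  have := Real.log_pos h
  positivity

lemma rpow_neg_le_gfun (n : ℕ) (s : ℝ) {t : ℝ} (ht : 3 < t) : t ^ (-s) ≤ gfun n s t := by
  rw [gfun, if_neg (not_le.2 ht), mul_assoc]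
  have h1 := one_le_wfun ht
  have h2 : 1 ≤ Real.log t ^ (n + 1) := one_le_pow₀ (one_lt_log_of_three_lt ht).le
  exact le_mul_of_one_le_right (by positivity) (one_le_mul_of_one_le_of_one_le h1 h2)

lemma gfun_pos (n : ℕ) (s t : ℝ) : 0 < gfun n s t := by
  by_cases ht : t ≤ 3
  · simp [gfun, ht]
  · have h := not_le.1 ht
    exact (Real.rpow_pos_of_pos (by linarith) _).trans_le (rpow_neg_le_gfun n s h)

lemma eventually_gfun_le_one (n : ℕ) {s : ℝ} (hs : 0 < s) :
    ∀ᶠ t in atTop, gfun n s t ≤ 1 := by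
  have h1 : ∀ᶠ t : ℝ in atTop, 2 / s ≤ Real.log (Real.log t) :=
    (Real.tendsto_log_atTop.comp Real.tendsto_log_atTop).eventually_ge_atTop _
  have h2 := (isLittleO_log_rpow_rpow_atTop ((n + 1 : ℕ) : ℝ) (half_pos hs)).bound one_pos
  filter_upwards [h1, h2, eventually_gt_atTop 3] with t h1 h2 ht
  have hl := one_lt_log_of_three_lt ht
  have ht0 : 0 < t := by linarith
  rw [gfun, if_neg (not_le.2 ht)]
  have h3 : wfun 1 t ≤ t ^ (s / 2) := by
    rw [wfun, Real.rpow_def_of_pos ht0, Real.exp_le_exp, one_mul,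
      div_le_iff₀ (lt_of_lt_of_le (by positivity) h1)]
    have : s / 2 * (2 / s) = 1 := by field_simp
    calc Real.log t = Real.log t * (s / 2) * (2 / s) := by rw [mul_assoc, this, mul_one]
      _ ≤ _ := by gcongr
  have h4 : Real.log t ^ (n + 1) ≤ t ^ (s / 2) := by
    rw [Real.rpow_natCast, one_mul, Real.norm_of_nonneg (by positivity),
      Real.norm_of_nonneg (by positivity)] at h2
    exact h2
  calc t ^ (-s) * wfun 1 t * Real.log t ^ (n + 1) ≤ t ^ (-s) * t ^ (s / 2) * t ^ (s / 2) := by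
        gcongr
    _ = 1 := by
        rw [← Real.rpow_add ht0, ← Real.rpow_add ht0, show -s + s / 2 + s / 2 = 0 by ring,
          Real.rpow_zero]

lemma div_log_le_div_log {u v : ℝ} (hu : Real.exp 1 ≤ u) (huv : u ≤ v) :
    u / Real.log u ≤ v / Real.log v := by
  have h := Real.log_div_self_antitoneOn hu (hu.trans huv) huv
  have hu0 : 0 < u := (Real.exp_pos 1).trans_le hu
  have hl : 0 < Real.log u := Real.log_pos (by linarith [Real.add_one_lt_exp one_ne_zero])
  have hl' : 0 < Real.log v := Real.log_pos (by linarith [Real.add_one_lt_exp one_ne_zero])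
  have hv0 := hu0.trans_le huv
  simp only at h
  rw [div_le_div_iff₀ hv0 hu0] at h
  rw [div_le_div_iff₀ hl hl']
  linarith

lemma wfun_le_two_mul {t τ : ℝ} (ht : Real.exp (Real.exp 1) ≤ t)
    (hτ : Real.exp (Real.exp 1) ≤ τ) (h : t ≤ 2 * τ) : wfun 1 t ≤ 2 * wfun 1 τ := by
  have hτ0 : 0 < τ := (Real.exp_pos _).trans_le hτ
  have ht0 : 0 < t := (Real.exp_pos _).trans_le ht
  have hu : Real.exp 1 ≤ Real.log t := (Real.le_log_iff_exp_le ht0).2 ht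
  have hv : Real.exp 1 ≤ Real.log τ := (Real.le_log_iff_exp_le hτ0).2 hτ
  have hb : 0 < Real.log 2 := Real.log_pos one_lt_two
  have h1 : Real.log t ≤ Real.log τ + Real.log 2 := by
    rw [add_comm, ← Real.log_mul two_ne_zero hτ0.ne']
    exact Real.log_le_log ht0 h
  have h2 := div_log_le_div_log hu h1
  have hl : 1 ≤ Real.log (Real.log τ) :=
    (Real.le_log_iff_exp_le ((Real.exp_pos 1).trans_le hv)).2 hv
  have hl' : Real.log (Real.log τ) ≤ Real.log (Real.log τ + Real.log 2) :=
    Real.log_le_log ((Real.exp_pos 1).trans_le hv) (by linarith)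
  have hv0 : 0 < Real.log τ := (Real.exp_pos 1).trans_le hv
  have h3 : (Real.log τ + Real.log 2) / Real.log (Real.log τ + Real.log 2) ≤
      Real.log τ / Real.log (Real.log τ) + Real.log 2 := by
    rw [add_div]
    gcongr
    exact div_le_self hb.le (hl.trans hl')
  rw [wfun, wfun, one_mul, one_mul]
  nth_rewrite 1 [← Real.exp_log (zero_lt_two (α := ℝ))]
  rw [← Real.exp_add, Real.exp_le_exp]
  linarith

/-- `g` varies slowly on the scale of polynomial weights. -/
lemma exists_gfun_le_mul (n : ℕ) {s : ℝ} (hs : 0 < s) :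
    ∃ B > 0, ∀ᶠ t in atTop, ∀ τ v : ℝ, 0 ≤ τ → 0 ≤ v → |τ - t| ≤ v →
      gfun n s t ≤ B * gfun n s τ * (1 + v) ^ s := by
  refine ⟨2 ^ s * (2 * 2 ^ (n + 1)), by positivity, ?_⟩
  filter_upwards [eventually_gfun_le_one n hs,
    eventually_ge_atTop (2 * Real.exp (Real.exp 1))] with t hg1 ht τ v hτ0 hv hτv
  have hee : (3 : ℝ) < Real.exp (Real.exp 1) := by
    have h1 := Real.add_one_lt_exp one_ne_zero
    have h2 := Real.add_one_lt_exp (Real.exp_pos 1).ne'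
    linarith
  have hB : (1 : ℝ) ≤ 2 * 2 ^ (n + 1) := by
    have : (1 : ℝ) ≤ 2 ^ (n + 1) := one_le_pow₀ one_le_two
    linarith
  have h2s : (1 : ℝ) ≤ 2 ^ s := Real.one_le_rpow one_le_two hs.le
  have hv1 : 1 ≤ (1 + v) ^ s := Real.one_le_rpow (by linarith) hs.le
  have hgτ := gfun_pos n s τ
  by_cases h3 : τ ≤ 3
  · refine hg1.trans ?_
    rw [gfun, if_pos h3, mul_one]
    exact one_le_mul_of_one_le_of_one_le (one_le_mul_of_one_le_of_one_le h2s hB) hv1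
  have h3' := not_le.1 h3
  obtain ⟨hl, hr⟩ := abs_le.1 hτv
  by_cases hcmp : t ≤ 2 * τ ∧ τ ≤ 2 * t
  · have hτe : Real.exp (Real.exp 1) ≤ τ := by linarith [hcmp.1]
    have hte : Real.exp (Real.exp 1) ≤ t := by linarith
    have hw := wfun_le_two_mul hte hτe hcmp.1
    have hlτ := one_lt_log_of_three_lt h3'
    have hlt := one_lt_log_of_three_lt (hee.trans_le hte)
    have hlog : Real.log t ≤ 2 * Real.log τ := by
      have : Real.log t ≤ Real.log 2 + Real.log τ := by
        rw [← Real.log_mul two_ne_zero (by linarith)]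
        exact Real.log_le_log (by linarith) hcmp.1
      linarith [Real.log_two_lt_d9]
    have hpow : t ^ (-s) ≤ 2 ^ s * τ ^ (-s) := by
      have h4 : (2 * t) ^ (-s) ≤ τ ^ (-s) :=
        Real.rpow_le_rpow_of_nonpos (by linarith) hcmp.2 (by linarith)
      rw [Real.mul_rpow (by norm_num) (by linarith), Real.rpow_neg (by norm_num)] at h4
      rwa [inv_mul_le_iff₀ (by positivity)] at h4
    have h5 : gfun n s t ≤ 2 ^ s * (2 * 2 ^ (n + 1)) * gfun n s τ := by
      rw [gfun, gfun, if_neg h3, if_neg (not_le.2 (hee.trans_le hte))]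
      have hw0 : 0 ≤ wfun 1 t := (Real.exp_pos _).le
      have hw1 : 0 ≤ wfun 1 τ := (Real.exp_pos _).le
      calc t ^ (-s) * wfun 1 t * Real.log t ^ (n + 1)
          ≤ (2 ^ s * τ ^ (-s)) * (2 * wfun 1 τ) * (2 * Real.log τ) ^ (n + 1) := by gcongr
        _ = _ := by rw [mul_pow]; ring
    exact h5.trans (le_mul_of_one_le_right (by positivity) hv1)
  · have hvτ : τ / 2 ≤ v := by
      by_cases h4 : t ≤ 2 * τ
      · have : 2 * t < τ := by
          by_contra h6
          exact hcmp ⟨h4, not_lt.1 h6⟩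
        linarith
      · linarith
    have h4 : 1 ≤ 2 ^ s * (τ ^ (-s) * (1 + v) ^ s) := by
      have h5 : (τ / 2) ^ s ≤ (1 + v) ^ s :=
        Real.rpow_le_rpow (by linarith) (by linarith) hs.le
      rw [Real.div_rpow hτ0 (by norm_num), div_le_iff₀ (by positivity)] at h5
      rw [Real.rpow_neg hτ0, ← mul_assoc, mul_comm (2 ^ s), mul_assoc, inv_mul_eq_div,
        one_le_div (Real.rpow_pos_of_pos (by linarith) _)]
      linarith
    have h6 := rpow_neg_le_gfun n s h3'
    calc gfun n s t ≤ 1 := hg1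
      _ ≤ 2 ^ s * (τ ^ (-s) * (1 + v) ^ s) := h4
      _ ≤ 2 ^ s * (gfun n s τ * (1 + v) ^ s) := by gcongr
      _ = 2 ^ s * 1 * gfun n s τ * (1 + v) ^ s := by ring
      _ ≤ _ := by gcongr

end GEstimates

section Blocks
variable {n : ℕ} {Q : Set (Fin n → ℤ)} {Ψ : (Fin n → ℤ) → ℝ} {s M : ℝ}

lemma one_le_norm_of_ne_zero {ι : Type*} [Fintype ι] {q : ι → ℤ} (hq : q ≠ 0) : 1 ≤ ‖q‖ := by
  obtain ⟨j, hj⟩ := Function.ne_iff.1 hq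
  refine le_trans ?_ (norm_le_pi_norm q j)
  rw [Int.norm_eq_abs]
  exact_mod_cast Int.one_le_abs hj

lemma PsiStar_mem_Ioc (hΨ : ∀ q, Ψ q ∈ Set.Ioc (0 : ℝ) (1 / 2)) {q : Fin n → ℤ} (hq : q ≠ 0) :
    PsiStar Ψ q ∈ Set.Ioc (0 : ℝ) (1 / 2) := by
  have h := one_le_norm_of_ne_zero hq
  exact ⟨div_pos (hΨ q).1 (by linarith), (div_le_self (hΨ q).1.le h).trans (hΨ q).2⟩

lemma ne_zero_of_mem_QM (hs : 0 < s) (hM : 0 < M) {q : Fin n → ℤ} (hq : q ∈ QM Q Ψ s M) :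
    q ≠ 0 := by
  rintro rfl
  have h := hq.2.1
  rw [PsiStar, norm_zero, div_zero, Real.zero_rpow (by linarith)] at h
  linarith

lemma rpow_neg_inv_le_PsiStar (hΨ : ∀ q, Ψ q ∈ Set.Ioc (0 : ℝ) (1 / 2)) (hs : 0 < s)
    (hM : 0 < M) {q : Fin n → ℤ} (hq : q ∈ QM Q Ψ s M) : M ^ (-(1 / s)) ≤ PsiStar Ψ q := by
  have h0 := (PsiStar_mem_Ioc hΨ (ne_zero_of_mem_QM hs hM hq)).1
  have h := Real.rpow_le_rpow_of_nonpos (by positivity) hq.2.2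
    (show -(1 / s) ≤ 0 by simp [hs.le])
  rwa [← Real.rpow_mul h0.le, show -s * -(1 / s) = 1 by field_simp, Real.rpow_one] at h

lemma finite_QM (hΨ : ∀ q, Ψ q ∈ Set.Ioc (0 : ℝ) (1 / 2)) (hs : 0 < s) (hM : 0 < M) :
    (QM Q Ψ s M).Finite := by
  refine ((isCompact_closedBall (0 : Fin n → ℤ) (M ^ (1 / s))).finite_of_discrete).subset ?_
  intro q hq
  have h := rpow_neg_inv_le_PsiStar hΨ hs hM hq
  have hq1 := one_le_norm_of_ne_zero (ne_zero_of_mem_QM hs hM hq)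
  rw [mem_closedBall_zero_iff]
  rw [PsiStar, le_div_iff₀ (by linarith), Real.rpow_neg hM.le,
    inv_mul_le_iff₀ (by positivity)] at h
  refine h.trans (mul_le_of_le_one_right (by positivity) ?_)
  linarith [(hΨ q).2]

lemma ne_zero_of_lt_sExp (hs : 0 < s) (hss : s < sExp Q Ψ) : n ≠ 0 := by
  rintro rfl
  have : sExp Q Ψ ≤ 0 := csInf_le ⟨0, fun _ h => h.1⟩ ⟨le_rfl, Summable.of_finite⟩
  linarith

lemma exists_mem_QM (hΨ : ∀ q, Ψ q ∈ Set.Ioc (0 : ℝ) (1 / 2)) (hs : 0 < s) {q : Fin n → ℤ}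
    (hq : q ∈ Q) (hq0 : q ≠ 0) : ∃ k : ℕ, q ∈ QM Q Ψ s (2 ^ k) := by
  obtain ⟨h0, h1⟩ := PsiStar_mem_Ioc hΨ hq0
  have hx : 1 < PsiStar Ψ q ^ (-s) :=
    Real.one_lt_rpow_of_pos_of_lt_one_of_neg h0 (by linarith) (by linarith)
  have hex : ∃ k : ℕ, PsiStar Ψ q ^ (-s) ≤ 2 ^ k := by
    obtain ⟨k, hk⟩ := pow_unbounded_of_one_lt (PsiStar Ψ q ^ (-s)) (one_lt_two (α := ℝ))
    exact ⟨k, hk.le⟩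
  classical
  refine ⟨Nat.find hex, hq, ?_, Nat.find_spec hex⟩
  obtain ⟨j, hj⟩ : ∃ j, Nat.find hex = j + 1 := by
    refine Nat.exists_eq_succ_of_ne_zero fun h => ?_
    have := Nat.find_spec hex
    rw [h, pow_zero] at this
    linarith
  have h2 := Nat.find_min hex (m := j) (by omega)
  rw [hj, pow_succ, mul_div_cancel_right₀ _ two_ne_zero]
  exact not_le.1 h2

lemma summable_subtype_of_summable_sigma {α : Type*} {f : α → ℝ} {S : ℕ → Set α} {T : Set α}
    (hT : ∀ q ∈ T, ∃ k, q ∈ S k) (h : Summable fun p : Σ k, S k => f p.2) :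
    Summable fun q : T => f q := by
  choose k hk using hT
  let i : T → Σ k, S k := fun q => ⟨k q q.2, ⟨q, hk q q.2⟩⟩
  have hi : Function.Injective i := fun q q' hqq =>
    Subtype.ext (congrArg (fun p : Σ k, S k => (p.2 : α)) hqq)
  exact h.comp_injective hi

/-- `𝓜` is infinite. -/
lemma frequently_le_tsum_QM (hΨ : ∀ q, Ψ q ∈ Set.Ioc (0 : ℝ) (1 / 2)) (hs : 0 < s)
    (hss : s < sExp Q Ψ) :
    ∃ᶠ k : ℕ in atTop, (((k : ℝ) ^ (n + 1))⁻¹ : ℝ) ≤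
      ∑' q : QM Q Ψ s (2 ^ k), PsiStar Ψ q ^ s := by
  have hn := ne_zero_of_lt_sExp hs hss
  by_contra hcon
  rw [not_frequently] at hcon
  have hnn : ∀ q, 0 ≤ PsiStar Ψ q ^ s := fun q =>
    Real.rpow_nonneg (div_nonneg (hΨ q).1.le (norm_nonneg _)) _
  have h1 : Summable fun k : ℕ => ∑' q : QM Q Ψ s (2 ^ k), PsiStar Ψ q ^ s := by
    have h2 : Summable fun k : ℕ => (((k : ℝ) ^ (n + 1))⁻¹ : ℝ) :=
      Real.summable_nat_pow_inv.2 (by omega)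
    refine h2.of_norm_bounded_eventually_nat ?_
    filter_upwards [hcon] with k hk
    rw [Real.norm_of_nonneg (tsum_nonneg fun q : QM Q Ψ s (2 ^ k) => hnn q)]
    exact (not_le.1 hk).le
  have h2 : Summable fun p : Σ k : ℕ, QM Q Ψ s (2 ^ k) => PsiStar Ψ p.2 ^ s := by
    refine (summable_sigma_of_nonneg fun p => hnn _).2 ⟨fun k => ?_, h1⟩
    have := (finite_QM (Q := Q) hΨ hs (M := 2 ^ k) (by positivity)).to_subtype
    exact Summable.of_finite
  have h3 : Summable fun q : {q | q ∈ Q ∧ q ≠ 0} => PsiStar Ψ q ^ s :=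
    summable_subtype_of_summable_sigma (f := fun q => PsiStar Ψ q ^ s)
      (fun q hq => exists_mem_QM hΨ hs hq.1 hq.2) h2
  have h4 : Summable fun q : Q => PsiStar Ψ q ^ s := by
    have h5 := (summable_subtype_iff_indicator (f := fun q => PsiStar Ψ q ^ s)).1 h3
    refine (summable_subtype_iff_indicator (f := fun q => PsiStar Ψ q ^ s)).2 ?_
    convert h5 using 1
    funext q
    by_cases hq : q ∈ Q
    · by_cases hq0 : q = 0
      · subst hq0
        simp [PsiStar, Set.indicator, hs.ne']
      · simp [Set.indicator, hq, hq0]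
    · simp [Set.indicator, hq]
  have h5 : sExp Q Ψ ≤ s := csInf_le ⟨0, fun _ h => h.1⟩ ⟨hs.le, h4⟩
  linarith

lemma le_ncard_QM (hΨ : ∀ q, Ψ q ∈ Set.Ioc (0 : ℝ) (1 / 2)) (hs : 0 < s) {k : ℕ} (hk : k ≠ 0)
    (h : (((k : ℝ) ^ (n + 1))⁻¹ : ℝ) ≤ ∑' q : QM Q Ψ s (2 ^ k), PsiStar Ψ q ^ s) :
    (2 : ℝ) ^ k / (2 * (k : ℝ) ^ (n + 1)) ≤ (QM Q Ψ s (2 ^ k)).ncard := by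
  have hM : (0 : ℝ) < 2 ^ k := by positivity
  have hfin := finite_QM (Q := Q) hΨ hs hM
  have := hfin.fintype
  rw [tsum_fintype] at h
  have h1 : ∑ q : QM Q Ψ s (2 ^ k), PsiStar Ψ q ^ s ≤
      ∑ _q : QM Q Ψ s (2 ^ k), (2 : ℝ) / 2 ^ k := by
    refine Finset.sum_le_sum fun q _ => ?_
    have hq := q.2.2.1
    have h0 := (PsiStar_mem_Ioc hΨ (ne_zero_of_mem_QM hs hM q.2)).1
    rw [Real.rpow_neg h0.le, lt_inv_comm₀ (by positivity) (by positivity), inv_div] at hq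
    exact hq.le
  rw [Finset.sum_const, Finset.card_univ, nsmul_eq_mul, ← Nat.card_eq_fintype_card,
    Nat.card_coe_set_eq] at h1
  have h2 := h.trans h1
  have hk' : (0 : ℝ) < (k : ℝ) ^ (n + 1) := by positivity
  rw [inv_le_iff_one_le_mul₀ hk'] at h2
  rw [div_le_iff₀ (by positivity)]
  have h3 : (1 : ℝ) * 2 ^ k ≤ ((QM Q Ψ s (2 ^ k)).ncard * (2 / 2 ^ k) * (k : ℝ) ^ (n + 1)) * 2 ^ k :=
    mul_le_mul_of_nonneg_right h2 hM.le
  field_simp at h3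
  linarith

end Blocks

section Counting
variable {n : ℕ}

lemma two_pow_mem_LM_iff {m : ℕ} {k : ℕ} {l : Fin m × Fin n → ℤ} :
    l ∈ LM m n (2 ^ k) ↔ l ≠ 0 ∧
      ‖l‖ ≤ ((2 : ℝ) ^ k / (2 * (k : ℝ) ^ (n + 1))) ^ ((1 : ℝ) / (2 * m * n)) := by
  have : Real.logb 2 ((2 : ℝ) ^ k) = k := by
    rw [← Real.rpow_natCast, Real.logb_rpow (by norm_num) (by norm_num)]
  simp only [LM, Set.mem_ofPred_eq, this]

lemma eventually_rpow_le_two_pow_div (n : ℕ) :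
    ∀ᶠ k : ℕ in atTop, (2 : ℝ) ^ ((k : ℝ) / 2) ≤ 2 ^ k / (2 * (k : ℝ) ^ (n + 1)) := by
  have h2 : (1 : ℝ) < 2 ^ ((1 : ℝ) / 2) := Real.one_lt_rpow one_lt_two (by norm_num)
  have h := tendsto_pow_const_div_const_pow_of_one_lt (n + 1) h2
  filter_upwards [h.eventually_le_const (show (0 : ℝ) < 1 / 2 by norm_num),
    eventually_gt_atTop 0] with k hk hk0
  have hk' : (0 : ℝ) < k := by exact_mod_cast hk0
  rw [← Real.rpow_natCast ((2 : ℝ) ^ (1 / 2 : ℝ)), ← Real.rpow_mul (by norm_num),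
    div_le_iff₀ (by positivity)] at hk
  rw [le_div_iff₀ (by positivity)]
  have h3 : (2 : ℝ) ^ ((1 : ℝ) / 2 * k) = 2 ^ ((k : ℝ) / 2) := by congr 1; ring
  have h4 : (2 : ℝ) ^ ((k : ℝ) / 2) * 2 ^ ((k : ℝ) / 2) = 2 ^ k := by
    rw [← Real.rpow_add (by norm_num), add_halves, Real.rpow_natCast]
  rw [h3] at hk
  rw [← h4]
  gcongr
  linarith

lemma exists_natCast_le_mul_log_norm (m n : ℕ) :
    ∃ c > 0, ∀ᶠ k : ℕ in atTop, ∀ l : Fin m × Fin n → ℤ, l ≠ 0 → l ∉ LM m n (2 ^ k) →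
      (k : ℝ) ≤ c * Real.log ‖l‖ := by
  refine ⟨4 * (m * n + 1) / Real.log 2, div_pos (by positivity) (Real.log_pos one_lt_two), ?_⟩
  filter_upwards [eventually_rpow_le_two_pow_div n] with k hk l hl hlL
  rw [two_pow_mem_LM_iff, not_and, not_le] at hlL
  have h1 := hlL hl
  obtain ⟨⟨i, j⟩, -⟩ := Function.ne_iff.1 hl
  have hm : (0 : ℝ) < m := by exact_mod_cast i.pos
  have hn : (0 : ℝ) < n := by exact_mod_cast j.pos
  have h2 : ((2 : ℝ) ^ ((k : ℝ) / 2)) ^ ((1 : ℝ) / (2 * m * n)) ≤ ‖l‖ :=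
    (Real.rpow_le_rpow (by positivity) hk (by positivity)).trans h1.le
  have h3 := Real.log_le_log (by positivity) h2
  rw [Real.log_rpow (by positivity), Real.log_rpow (by norm_num)] at h3
  have hl2 : 0 < Real.log 2 := Real.log_pos one_lt_two
  have h4 : (k : ℝ) * Real.log 2 ≤ 4 * (m * n) * Real.log ‖l‖ := by
    calc (k : ℝ) * Real.log 2 =
          4 * (m * n) * (1 / (2 * m * n) * (k / 2 * Real.log 2)) := by field_simp; norm_num
      _ ≤ _ := by gcongr
  have h5 : 0 ≤ Real.log ‖l‖ := Real.log_nonneg (one_le_norm_of_ne_zero hl)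
  rw [div_mul_eq_mul_div, le_div_iff₀ hl2]
  refine h4.trans ?_
  gcongr
  linarith

lemma exists_finset_norm_le_card_le {ι : Type*} [Fintype ι] {R : ℝ} (hR : 1 ≤ R) :
    ∃ u : Finset (ι → ℤ), (∀ l : ι → ℤ, ‖l‖ ≤ R → l ∈ u) ∧
      (u.card : ℝ) ≤ (3 * R) ^ Fintype.card ι := by
  classical
  refine ⟨Fintype.piFinset fun _ => Finset.Icc (-⌊R⌋) ⌊R⌋, fun l hl => ?_, ?_⟩
  · rw [Fintype.mem_piFinset]
    intro i
    have h := (norm_le_pi_norm l i).trans hl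
    rw [Int.norm_eq_abs] at h
    have h' : |l i| ≤ ⌊R⌋ := Int.le_floor.2 (by exact_mod_cast h)
    exact Finset.mem_Icc.2 (abs_le.1 h')
  · rw [Fintype.card_piFinset, Finset.prod_const, Finset.card_univ, Nat.cast_pow]
    refine pow_le_pow_left₀ (by positivity) ?_ _
    rw [Int.card_Icc]
    have h0 : 0 ≤ ⌊R⌋ := Int.floor_nonneg.2 (by linarith)
    have h1 : (((⌊R⌋ + 1 - -⌊R⌋).toNat : ℤ) : ℝ) = 2 * ⌊R⌋ + 1 := by
      rw [Int.toNat_of_nonneg (by omega)]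
      push_cast
      ring
    rw [Int.cast_natCast] at h1
    rw [h1]
    linarith [Int.floor_le R]

lemma exists_ncard_biUnion_Dset_le (m n : ℕ) : ∃ A > 0, ∀ X : ℝ, 1 ≤ X →
    (⋃ l ∈ {l : Fin m × Fin n → ℤ | l ≠ 0 ∧ ‖l‖ ≤ X ^ ((1 : ℝ) / (2 * m * n))},
      Dset m n l).Finite ∧
    ((⋃ l ∈ {l : Fin m × Fin n → ℤ | l ≠ 0 ∧ ‖l‖ ≤ X ^ ((1 : ℝ) / (2 * m * n))},
      Dset m n l).ncard : ℝ) ≤ A * X ^ (3 / 4 : ℝ) := by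
  obtain ⟨A, hA, h⟩ := exists_ncard_Dset_le_sqrt m n
  refine ⟨3 ^ (m * n) * A, by positivity, fun X hX => ?_⟩
  set R := X ^ ((1 : ℝ) / (2 * m * n)) with hRdef
  have hR : 1 ≤ R := Real.one_le_rpow hX (by positivity)
  obtain ⟨u, hu, hcard⟩ := exists_finset_norm_le_card_le (ι := Fin m × Fin n) hR
  rw [Fintype.card_prod, Fintype.card_fin, Fintype.card_fin] at hcard
  classical
  have heq : (⋃ l ∈ {l : Fin m × Fin n → ℤ | l ≠ 0 ∧ ‖l‖ ≤ R}, Dset m n l) =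
      ⋃ l ∈ u.filter (fun l => l ≠ 0 ∧ ‖l‖ ≤ R), Dset m n l := by
    ext q
    simp only [Set.mem_iUnion, Set.mem_ofPred_eq, Finset.mem_filter, exists_prop]
    exact exists_congr fun l => ⟨fun h => ⟨⟨hu l h.1.2, h.1⟩, h.2⟩, fun h => ⟨h.1.2, h.2⟩⟩
  have hfin : ∀ l : Fin m × Fin n → ℤ, l ≠ 0 → (Dset m n l).Finite := fun l hl => by
    obtain ⟨p, hp⟩ := Function.ne_iff.1 hl
    exact (Dset_finite_ncard_le hp).1
  rw [heq]
  constructor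
  · exact Set.Finite.biUnion (Finset.finite_toSet _)
      fun l hl => hfin l (Finset.mem_filter.1 (Finset.mem_coe.1 hl)).2.1
  by_cases hmn : m * n = 0
  · have hempty : u.filter (fun l => l ≠ 0 ∧ ‖l‖ ≤ R) = ∅ := by
      refine Finset.filter_eq_empty_iff.2 fun l _ hl => ?_
      obtain ⟨⟨i, j⟩, -⟩ := Function.ne_iff.1 hl.1
      exact (Nat.mul_pos i.pos j.pos).ne' hmn
    rw [hempty]
    simp only [Finset.notMem_empty, Set.iUnion_of_empty, Set.iUnion_empty, Set.ncard_empty,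
      Nat.cast_zero]
    positivity
  have hRpow : R ^ (m * n) = X ^ (1 / 2 : ℝ) := by
    have h1 : (m : ℝ) * n ≠ 0 := by exact_mod_cast hmn
    rw [hRdef, ← Real.rpow_natCast, ← Real.rpow_mul (by linarith)]
    congr 1
    push_cast
    rw [mul_assoc, one_div_mul_eq_div, mul_comm (2 : ℝ), ← div_div, div_self h1]
  have hRsqrt : R ^ (1 / 2 : ℝ) ≤ X ^ (1 / 4 : ℝ) := by
    have h1 : R ≤ X ^ (1 / 2 : ℝ) := by
      rw [← hRpow]
      exact le_self_pow₀ hR hmn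
    refine (Real.rpow_le_rpow (by linarith) h1 (by norm_num)).trans_eq ?_
    rw [← Real.rpow_mul (by linarith)]
    norm_num
  calc ((⋃ l ∈ u.filter (fun l => l ≠ 0 ∧ ‖l‖ ≤ R), Dset m n l).ncard : ℝ)
      ≤ ∑ l ∈ u.filter (fun l => l ≠ 0 ∧ ‖l‖ ≤ R), ((Dset m n l).ncard : ℝ) := by
        exact_mod_cast Finset.set_ncard_biUnion_le _ _
    _ ≤ ∑ _l ∈ u.filter (fun l => l ≠ 0 ∧ ‖l‖ ≤ R), A * X ^ (1 / 4 : ℝ) := by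
        refine Finset.sum_le_sum fun l hl => ?_
        obtain ⟨-, hl0, hlR⟩ := Finset.mem_filter.1 hl
        refine (h l hl0).trans ?_
        gcongr
        exact (Real.rpow_le_rpow (norm_nonneg _) hlR (by norm_num)).trans hRsqrt
    _ ≤ u.card * (A * X ^ (1 / 4 : ℝ)) := by
        rw [Finset.sum_const, nsmul_eq_mul]
        gcongr
        exact Finset.filter_subset _ _
    _ ≤ (3 * R) ^ (m * n) * (A * X ^ (1 / 4 : ℝ)) := by gcongr
    _ = 3 ^ (m * n) * A * X ^ (3 / 4 : ℝ) := by
        rw [mul_pow, hRpow, show (3 / 4 : ℝ) = 1 / 2 + 1 / 4 by norm_num,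
          Real.rpow_add (by linarith)]
        ring

/-- Removing the divisors of small `ℓ` from `Q(M)` loses at most half of the guaranteed elements. -/
lemma eventually_le_ncard_QM' (m : ℕ) {Q : Set (Fin n → ℤ)} {Ψ : (Fin n → ℤ) → ℝ} {s : ℝ}
    (hΨ : ∀ q, Ψ q ∈ Set.Ioc (0 : ℝ) (1 / 2)) (hs : 0 < s) :
    ∀ᶠ k : ℕ in atTop,
      (((k : ℝ) ^ (n + 1))⁻¹ : ℝ) ≤ ∑' q : QM Q Ψ s (2 ^ k), PsiStar Ψ q ^ s →
      (2 : ℝ) ^ k / (4 * (k : ℝ) ^ (n + 1)) ≤ (QM' m Q Ψ s (2 ^ k)).ncard := by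
  obtain ⟨A, hA, h⟩ := exists_ncard_biUnion_Dset_le m n
  have hX : Tendsto (fun k : ℕ => (2 : ℝ) ^ k / (2 * (k : ℝ) ^ (n + 1))) atTop atTop := by
    refine tendsto_atTop_mono' _ (eventually_rpow_le_two_pow_div n) ?_
    have h1 : Tendsto (fun k : ℕ => (k : ℝ) / 2) atTop atTop :=
      tendsto_natCast_atTop_atTop.atTop_div_const two_pos
    exact (tendsto_rpow_atTop_of_base_gt_one 2 one_lt_two).comp h1
  have hX' := (tendsto_rpow_atTop (show (0 : ℝ) < 1 / 4 by norm_num)).comp hX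
  filter_upwards [hX.eventually_ge_atTop 1, hX'.eventually_ge_atTop (2 * A),
    eventually_ne_atTop 0] with k h1 h2 hk hsum
  have h3 := le_ncard_QM hΨ hs hk hsum
  obtain ⟨hfin, hcard⟩ := h _ h1
  have h4 : QM' m Q Ψ s (2 ^ k) = QM Q Ψ s (2 ^ k) \ ⋃ l ∈ {l : Fin m × Fin n → ℤ | l ≠ 0 ∧
      ‖l‖ ≤ ((2 : ℝ) ^ k / (2 * (k : ℝ) ^ (n + 1))) ^ ((1 : ℝ) / (2 * m * n))}, Dset m n l := by
    rw [QM', show LM m n (2 ^ k) = {l : Fin m × Fin n → ℤ | l ≠ 0 ∧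
      ‖l‖ ≤ ((2 : ℝ) ^ k / (2 * (k : ℝ) ^ (n + 1))) ^ ((1 : ℝ) / (2 * m * n))} from
        Set.ext fun l => two_pow_mem_LM_iff]
  rw [h4]
  have h5 := Set.ncard_le_ncard_sdiff_add_ncard (QM Q Ψ s (2 ^ k)) _ hfin
  rw [← Nat.cast_le (α := ℝ), Nat.cast_add] at h5
  have hXX : (2 : ℝ) ^ k / (4 * (k : ℝ) ^ (n + 1)) =
      (2 : ℝ) ^ k / (2 * (k : ℝ) ^ (n + 1)) / 2 := by
    rw [div_div]; congr 1; ring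
  rw [hXX]
  simp only [Function.comp_apply] at h2
  generalize (2 : ℝ) ^ k / (2 * (k : ℝ) ^ (n + 1)) = X at *
  have h6 : X = X ^ (1 / 4 : ℝ) * X ^ (3 / 4 : ℝ) := by
    rw [← Real.rpow_add (by linarith)]
    norm_num
  have h7 : 2 * A * X ^ (3 / 4 : ℝ) ≤ X := by
    nth_rewrite 2 [h6]
    exact mul_le_mul_of_nonneg_right h2 (by positivity)
  linarith

end Counting

section Assembly
variable {m n : ℕ}

lemma intVec_zero {ι : Type*} [Fintype ι] : intVec (0 : ι → ℤ) = 0 := by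
  funext i
  simp [intVec]

lemma norm_tens (k : Fin m → ℤ) (q : Fin n → ℤ) : ‖tens k q‖ = ‖k‖ * ‖q‖ := by
  refine le_antisymm ?_ ?_
  · refine (pi_norm_le_iff_of_nonneg (by positivity)).2 fun p => ?_
    rw [tens, norm_mul]
    gcongr <;> exact norm_le_pi_norm _ _
  · by_cases hk : k = 0
    · simp [hk]
    have hk0 : 0 < ‖k‖ := norm_pos_iff.2 hk
    rw [mul_comm, ← le_div_iff₀ hk0]
    refine (pi_norm_le_iff_of_nonneg (by positivity)).2 fun j => ?_
    rw [le_div_iff₀ hk0, mul_comm]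
    by_cases hj : q j = 0
    · simp [hj]
    have hj0 : 0 < ‖q j‖ := norm_pos_iff.2 hj
    rw [← le_div_iff₀ hj0]
    refine (pi_norm_le_iff_of_nonneg (by positivity)).2 fun i => ?_
    rw [le_div_iff₀ hj0, ← norm_mul]
    exact norm_le_pi_norm (tens k q) (i, j)

lemma tens_injective {q : Fin n → ℤ} (hq : q ≠ 0) :
    Function.Injective fun k : Fin m → ℤ => tens k q := by
  obtain ⟨j, hj⟩ := Function.ne_iff.1 hq
  intro k k' h
  funext i
  exact mul_right_cancel₀ hj (congrFun h (i, j))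

lemma norm_ftPi_mul_PhiQ_sub_le {φ : (Fin m → ℝ) → ℝ} (hφ : Integrable φ)
    (hc : HasCompactSupport φ) (hφ1 : ftPi (fun y => (φ y : ℂ)) 0 = 1) {ε : ℝ} (hε : 0 < ε)
    (hs : Summable fun k : Fin m → ℤ => ‖ftPi (fun y => (φ y : ℂ)) (ε • intVec k)‖)
    {q : Fin n → ℤ} (hq : q ≠ 0) (θ : Fin m → ℝ) {χ : (Fin m × Fin n → ℝ) → ℂ}
    (hχ : Integrable χ) (ξ : Fin m × Fin n → ℝ) {f : (Fin m × Fin n → ℤ) → ℝ}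
    (hf : Summable f) (hf0 : ∀ l, 0 ≤ f l)
    (hbound : ∀ k : Fin m → ℤ, k ≠ 0 → ‖ftPi (fun y => (φ y : ℂ)) (ε • intVec k)‖ *
      ‖ftPi χ (ξ - intVec (tens k q))‖ ≤ f (tens k q)) :
    ‖ftPi (fun x => χ x * (PhiQ φ ε q θ x : ℂ)) ξ - ftPi χ ξ‖ ≤ ∑' l, f l := by
  have h := (hasSum_ftPi_mul_PhiQ hφ hc hε hs hq θ hχ ξ).2
  have h0 := h.update 0 0
  have ht0 : tens (0 : Fin m → ℤ) q = 0 := by funext p; simp [tens]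
  rw [ht0, intVec_zero, intVec_zero, smul_zero, sub_zero, hφ1, eDot_zero_right, one_mul, one_mul] at h0
  have hfi : Summable fun k : Fin m → ℤ => f (tens k q) := hf.comp_injective (tens_injective hq)
  have h1 := h0.norm_le_of_bounded hfi.hasSum fun k => ?_
  · rw [zero_sub, neg_add_eq_sub] at h1
    exact h1.trans (tsum_comp_le_tsum_of_inj hf hf0 (tens_injective hq))
  · by_cases hk : k = 0
    · subst hk
      simpa using hf0 _
    · rw [Function.update_of_ne hk, norm_mul, norm_mul, norm_eDot, mul_one]
      exact hbound k hk

lemma norm_ftRmn_mul_FM_sub_le {φ : (Fin m → ℝ) → ℝ} (hφ : Integrable φ)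
    (hc : HasCompactSupport φ) (hφ1 : ftPi (fun y => (φ y : ℂ)) 0 = 1)
    {Ψ : (Fin n → ℤ) → ℝ} (hΨ : ∀ q, 0 < Ψ q)
    (hs : ∀ ε : ℝ, 0 < ε →
      Summable fun k : Fin m → ℤ => ‖ftPi (fun y => (φ y : ℂ)) (ε • intVec k)‖)
    {P : Set (Fin n → ℤ)} (hP : P.Finite) (hPne : P.Nonempty) (hP0 : ∀ q ∈ P, q ≠ 0)
    (θ : Fin m → ℝ) {χ : (Fin m × Fin n → ℝ) → ℝ} (hχ : Integrable χ)
    (ξ : Fin m × Fin n → ℝ) {b β : (Fin m × Fin n → ℤ) → ℝ}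
    (hb : Summable b) (hb0 : ∀ l, 0 ≤ b l)
    (hbound : ∀ q ∈ P, ∀ k : Fin m → ℤ,
      ‖ftPi (fun y => (φ y : ℂ)) (Ψ q • intVec k)‖ *
        ‖ftPi (fun x => (χ x : ℂ)) (ξ - intVec (tens k q))‖ ≤ b (tens k q))
    (hβ : Summable β) (hβ0 : ∀ l, 0 ≤ β l)
    (hcount : ∀ l, l ≠ 0 → (P.ncard : ℝ)⁻¹ * ((P ∩ Dset m n l).ncard * b l) ≤ β l) :
    ‖ftRmn (fun x => χ x * FM φ Ψ θ P x) ξ - ftRmn χ ξ‖ ≤ ∑' l, β l := by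
  classical
  lift P to Finset (Fin n → ℤ) using hP
  simp only [Finset.mem_coe] at hP0 hbound
  have hχ' : Integrable fun x => (χ x : ℂ) := hχ.ofReal
  have hN : (0 : ℝ) < P.card := by exact_mod_cast Finset.card_pos.2 (by simpa using hPne)
  have hNC : (P.card : ℂ) ≠ 0 := by exact_mod_cast hN.ne'
  have hexp : ftRmn (fun x => χ x * FM φ Ψ θ P x) ξ =
      (P.card : ℂ)⁻¹ * ∑ q ∈ P, ftPi (fun x => (χ x : ℂ) * (PhiQ φ (Ψ q) q θ x : ℂ)) ξ := by
    have h1 : ∀ q ∈ P, Integrable fun x =>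
        eDot x ξ * ((χ x : ℂ) * (PhiQ φ (Ψ q) q θ x : ℂ)) := fun q hq =>
      (hasSum_ftPi_mul_PhiQ hφ hc (hΨ q) (hs _ (hΨ q)) (hP0 q hq) θ hχ' ξ).1.bdd_mul (c := 1)
        (continuous_eDot _).aestronglyMeasurable
        (Eventually.of_forall fun x => (norm_eDot _ _).le)
    have h2 : ∀ x, FM φ Ψ θ P x = (P.card : ℝ)⁻¹ * ∑ q ∈ P, PhiQ φ (Ψ q) q θ x := fun x => by
      rw [FM, Set.ncard_coe_finset]
      congr 1
      exact Finset.tsum_subtype P fun q => PhiQ φ (Ψ q) q θ x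
    simp only [ftPi]
    rw [← integral_finsetSum _ h1, ← integral_const_mul]
    change ∫ x, eDot x ξ * ((χ x * FM φ Ψ θ P x : ℝ) : ℂ) = _
    congr 1
    funext x
    rw [h2]
    push_cast
    simp only [Finset.mul_sum]
    exact Finset.sum_congr rfl fun q _ => by ring
  have hχξ : ftRmn χ ξ = (P.card : ℂ)⁻¹ * ∑ _q ∈ P, ftPi (fun x => (χ x : ℂ)) ξ := by
    rw [Finset.sum_const, nsmul_eq_mul, inv_mul_cancel_left₀ hNC]
    rfl
  rw [hexp, hχξ, ← mul_sub, ← Finset.sum_sub_distrib, norm_mul, norm_inv, Complex.norm_natCast]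
  set f : (Fin n → ℤ) → (Fin m × Fin n → ℤ) → ℝ :=
    fun q l => if l ≠ 0 ∧ q ∈ Dset m n l then b l else 0 with hfdef
  have hf0 : ∀ q l, 0 ≤ f q l := fun q l => by
    simp only [hfdef]
    split_ifs
    exacts [hb0 l, le_rfl]
  have hf : ∀ q, Summable (f q) := fun q => hb.of_nonneg_of_le (hf0 q) fun l => by
    simp only [hfdef]
    split_ifs
    exacts [le_rfl, hb0 l]
  have hterm : ∀ q ∈ P, ‖ftPi (fun x => (χ x : ℂ) * (PhiQ φ (Ψ q) q θ x : ℂ)) ξ -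
      ftPi (fun x => (χ x : ℂ)) ξ‖ ≤ ∑' l, f q l := fun q hq => by
    refine norm_ftPi_mul_PhiQ_sub_le hφ hc hφ1 (hΨ q) (hs _ (hΨ q)) (hP0 q hq) θ hχ' ξ
      (hf q) (hf0 q) fun k hk => ?_
    have h1 : tens k q ≠ 0 ∧ q ∈ Dset m n (tens k q) := by
      refine ⟨?_, k, fun i j => rfl⟩
      rw [← norm_pos_iff, norm_tens]
      exact mul_pos (norm_pos_iff.2 hk) (norm_pos_iff.2 (hP0 q hq))
    simp only [hfdef, if_pos h1]
    exact hbound q hq k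
  have hsum : Summable fun l => (P.card : ℝ)⁻¹ * ∑ q ∈ P, f q l :=
    (summable_sum fun q _ => hf q).mul_left _
  calc (P.card : ℝ)⁻¹ * ‖∑ q ∈ P, (ftPi (fun x => (χ x : ℂ) * (PhiQ φ (Ψ q) q θ x : ℂ)) ξ -
        ftPi (fun x => (χ x : ℂ)) ξ)‖
      ≤ (P.card : ℝ)⁻¹ * ∑ q ∈ P, ∑' l, f q l := by
        gcongr
        exact norm_sum_le_of_le _ hterm
    _ = ∑' l, (P.card : ℝ)⁻¹ * ∑ q ∈ P, f q l := by
        rw [tsum_mul_left, Summable.tsum_finsetSum fun q _ => hf q]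
    _ ≤ ∑' l, β l := by
        refine hsum.tsum_le_tsum (fun l => ?_) hβ
        by_cases hl : l = 0
        · simpa [hfdef, hl] using hβ0 0
        refine le_trans (le_of_eq ?_) (hcount l hl)
        rw [Set.ncard_coe_finset]
        congr 1
        have h2 : (↑P ∩ Dset m n l : Set (Fin n → ℤ)) =
            ↑(P.filter fun q => q ∈ Dset m n l) := by
          ext q
          simp
        rw [h2, Set.ncard_coe_finset]
        simp only [hfdef, hl, ne_eq, not_false_eq_true, true_and]
        rw [← Finset.sum_filter, Finset.sum_const, nsmul_eq_mul]

/-- The weight of a single frequency of size `t` in `(χ F_M)^`. -/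
lemma inv_mul_mul_rpow_le_gfun {n k K : ℕ} {s c η t C N D : ℝ} (hs : 0 < s) (hsK : s ≤ K)
    (hk : k ≠ 0) (ht : 3 < t) (hC : 0 ≤ C) (hη : 0 ≤ η)
    (hkt : (k : ℝ) ≤ c * Real.log t) (hN : (2 : ℝ) ^ k / (4 * (k : ℝ) ^ (n + 1)) ≤ N)
    (hD0 : 0 ≤ D) (hD : D ≤ η * wfun 1 t) :
    N⁻¹ * (D * (C * (1 + ((2 : ℝ) ^ k) ^ (-(1 / s)) * t) ^ (-(K : ℝ)))) ≤
      4 * C * η * c ^ (n + 1) * gfun n s t := by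
  have ht0 : 0 < t := by linarith
  have hk0 : (0 : ℝ) < k := by positivity
  have h1 : N⁻¹ ≤ 4 * (k : ℝ) ^ (n + 1) / 2 ^ k := by
    rw [← inv_div]
    exact inv_anti₀ (by positivity) hN
  have hN0 : 0 ≤ N := le_trans (by positivity) hN
  set y := ((2 : ℝ) ^ k) ^ (-(1 / s)) * t with hy
  have hy0 : 0 < y := by positivity
  have h2 : (1 + y) ^ (-(K : ℝ)) ≤ 2 ^ k * t ^ (-s) := by
    calc (1 + y) ^ (-(K : ℝ)) ≤ (1 + y) ^ (-s) :=
          Real.rpow_le_rpow_of_exponent_le (by linarith) (by linarith)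
      _ ≤ y ^ (-s) := Real.rpow_le_rpow_of_nonpos hy0 (by linarith) (by linarith)
      _ = 2 ^ k * t ^ (-s) := by
          rw [hy, Real.mul_rpow (by positivity) ht0.le, ← Real.rpow_mul (by positivity),
            show -(1 / s) * -s = 1 by field_simp, Real.rpow_one]
  have hw : 0 ≤ wfun 1 t := (Real.exp_pos _).le
  rw [gfun, if_neg (not_le.2 ht)]
  calc N⁻¹ * (D * (C * (1 + y) ^ (-(K : ℝ))))
      ≤ (4 * (k : ℝ) ^ (n + 1) / 2 ^ k) * ((η * wfun 1 t) * (C * (2 ^ k * t ^ (-s)))) := by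
        gcongr
    _ = 4 * C * η * (k : ℝ) ^ (n + 1) * (t ^ (-s) * wfun 1 t) := by
        field_simp
    _ ≤ 4 * C * η * (c * Real.log t) ^ (n + 1) * (t ^ (-s) * wfun 1 t) := by gcongr
    _ = _ := by rw [mul_pow]; ring

end Assembly

section Summability

lemma summable_norm_ftPi_smul_intVec {m K : ℕ} {φ : (Fin m → ℝ) → ℝ} {C : ℝ} (hC : 0 ≤ C)
    (hK : ((Fintype.card (Fin m) : ℕ) : ℝ) < K)
    (hdecay : ∀ ξ : Fin m → ℝ,
      ‖ftPi (fun y => (φ y : ℂ)) ξ‖ ≤ C * (1 + ‖ξ‖) ^ (-(K : ℝ))) {ε : ℝ} (hε : 0 < ε) :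
    Summable fun k : Fin m → ℤ => ‖ftPi (fun y => (φ y : ℂ)) (ε • intVec k)‖ := by
  set μ := min ε 1 with hμdef
  have hμ : 0 < μ := lt_min hε one_pos
  refine ((summable_one_add_norm_rpow hK).mul_left (C * μ ^ (-(K : ℝ)))).of_nonneg_of_le
    (fun _ => norm_nonneg _) fun k => ?_
  refine (hdecay _).trans ?_
  rw [mul_assoc, ← Real.mul_rpow hμ.le (by positivity)]
  refine mul_le_mul_of_nonneg_left ?_ hC
  refine Real.rpow_le_rpow_of_nonpos (by positivity) ?_ (by simp)
  rw [norm_smul, norm_intVec, Real.norm_of_nonneg hε.le, mul_add, mul_one]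
  have h1 : μ ≤ 1 := min_le_right _ _
  have h2 : μ ≤ ε := min_le_left _ _
  gcongr

end Summability

/-- Stability Lemma: for every `δ > 0`, `M₀ > 0` and compactly supported `C^K` function `χ`
on `ℝ^{mn}` there is `M* ∈ 𝓜` with `M* ≥ M₀` such that
`|(χ F_{M*})^(ξ) - χ̂(ξ)| ≤ δ g(ξ)` for all `ξ`. -/
theorem stability_lemma (m n : ℕ) (Q : Set (Fin n → ℤ)) (Ψ : (Fin n → ℤ) → ℝ)
    (hΨ : ∀ q, Ψ q ∈ Set.Ioc (0 : ℝ) (1 / 2)) (θ : Fin m → ℝ)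
    (s : ℝ) (hs : 0 < s) (hss : s < sExp Q Ψ)
    (φ : (Fin m → ℝ) → ℝ) (hφ0 : ∀ x, 0 ≤ φ x) (hmeas : Measurable φ)
    (hsupp : Function.support φ ⊆ {x | ∀ i, x i ∈ Set.Ioo (-1 : ℝ) 1})
    (hint : ∫ x : Fin m → ℝ, φ x = 1)
    (K : ℕ) (hK : (m * n : ℝ) + s < K) (C : ℝ)
    (hdecay : ∀ ξ : Fin m → ℝ, ‖ftRm φ ξ‖ ≤ C * (1 + ‖ξ‖) ^ (-(K : ℝ)))
    (δ : ℝ) (hδ : 0 < δ) (M₀ : ℝ) (hM₀ : 0 < M₀)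
    (χ : (Fin m × Fin n → ℝ) → ℝ) (hχ : ContDiff ℝ K χ) (hχc : HasCompactSupport χ) :
    ∃ Mstar ∈ Mcal Q Ψ s, M₀ ≤ Mstar ∧
      ∀ ξ : Fin m × Fin n → ℝ,
        ‖ftRmn (fun x => χ x * FM φ Ψ θ (QM' m Q Ψ s Mstar) x) ξ - ftRmn χ ξ‖ ≤
          δ * gfun n s ‖ξ‖ := by
  have hφi : Integrable φ := by
    by_contra h
    rw [integral_undef h] at hint
    exact zero_ne_one hint
  have hφc : HasCompactSupport φ := by
    refine HasCompactSupport.intro (isCompact_closedBall (0 : Fin m → ℝ) 1) fun x hx => ?_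
    by_contra h
    refine hx (mem_closedBall_zero_iff.2 ((pi_norm_le_iff_of_nonneg zero_le_one).2 fun i => ?_))
    have := hsupp h i
    exact abs_le.2 ⟨this.1.le, this.2.le⟩
  have hφ1 : ftPi (fun y => (φ y : ℂ)) 0 = 1 := by
    simp only [ftPi, eDot_zero_right, one_mul]
    rw [integral_complex_ofReal, hint, Complex.ofReal_one]
  have hC : 0 < C := by
    have h := hdecay 0
    rw [norm_zero, add_zero, Real.one_rpow, mul_one] at h
    refine lt_of_lt_of_le ?_ h
    change 0 < ‖ftPi (fun y => (φ y : ℂ)) 0‖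
    rw [hφ1, norm_one]
    exact one_pos
  have hn : n ≠ 0 := ne_zero_of_lt_sExp hs hss
  have hmK : ((Fintype.card (Fin m) : ℕ) : ℝ) < K := by
    rw [Fintype.card_fin]
    have h1 : (m : ℝ) ≤ m * n := by
      exact_mod_cast Nat.le_mul_of_pos_right m (Nat.pos_of_ne_zero hn)
    linarith
  have hKs : ((Fintype.card (Fin m × Fin n) : ℕ) : ℝ) < K - s := by
    rw [Fintype.card_prod, Fintype.card_fin, Fintype.card_fin]
    push_cast
    linarith
  have hsK : s ≤ K := by
    have : (0 : ℝ) ≤ m * n := by positivity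
    linarith
  have hsum : ∀ ε : ℝ, 0 < ε →
      Summable fun k : Fin m → ℤ => ‖ftPi (fun y => (φ y : ℂ)) (ε • intVec k)‖ :=
    fun ε hε => summable_norm_ftPi_smul_intVec hC.le hmK hdecay hε
  obtain ⟨Aχ, hAχ, hχdecay⟩ := exists_norm_ftPi_le hχ hχc
  obtain ⟨A, hA, hAsum⟩ := exists_tsum_one_add_norm_sub_le (ι := Fin m × Fin n) hKs
  obtain ⟨B, hB, hg⟩ := exists_gfun_le_mul n hs
  obtain ⟨c, hc, hlog⟩ := exists_natCast_le_mul_log_norm m n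
  set η : ℝ := δ / (4 * C * c ^ (n + 1) * B * Aχ * A) with hηdef
  have hη : 0 < η := by positivity
  obtain ⟨T, hT⟩ := eventually_atTop.1 ((hg.and (eventually_ncard_Dset_le m n hη)).and
    (eventually_gt_atTop (3 : ℝ)))
  have hT3 : 3 < T := (hT T le_rfl).2
  obtain ⟨k, hk, hkN, hkl, hkT, hkM, hk0⟩ := ((frequently_le_tsum_QM hΨ hs hss).and_eventually
    ((eventually_le_ncard_QM' m hΨ hs).and (hlog.and
      ((tendsto_natCast_atTop_atTop.eventually_ge_atTop (c * Real.log T)).and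
        (((tendsto_pow_atTop_atTop_of_one_lt (one_lt_two (α := ℝ))).eventually_ge_atTop M₀).and
          (eventually_ne_atTop 0)))))).exists
  refine ⟨2 ^ k, ⟨k, rfl, hk⟩, hkM, fun ξ => ?_⟩
  have hN := hkN hk
  have hM : (0 : ℝ) < 2 ^ k := by positivity
  have hPfin : (QM' m Q Ψ s (2 ^ k)).Finite := (finite_QM hΨ hs hM).subset Set.sdiff_subset
  have hPne : (QM' m Q Ψ s (2 ^ k)).Nonempty := by
    refine Set.nonempty_of_ncard_ne_zero fun h => ?_
    rw [h, Nat.cast_zero] at hN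
    have : (0 : ℝ) < 2 ^ k / (4 * (k : ℝ) ^ (n + 1)) := by positivity
    linarith
  have hKs' : ((Fintype.card (Fin m × Fin n) : ℕ) : ℝ) < K := by linarith
  obtain ⟨_, _, hKsum⟩ := exists_tsum_one_add_norm_sub_le (ι := Fin m × Fin n) hKs'
  set v : (Fin m × Fin n → ℤ) → ℝ := fun l => ‖ξ - intVec l‖ with hv
  set b : (Fin m × Fin n → ℤ) → ℝ := fun l =>
    C * (1 + ((2 : ℝ) ^ k) ^ (-(1 / s)) * ‖l‖) ^ (-(K : ℝ)) *
      ‖ftPi (fun x => (χ x : ℂ)) (ξ - intVec l)‖ with hb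
  have hdec : ∀ l : Fin m × Fin n → ℤ,
      (1 + ((2 : ℝ) ^ k) ^ (-(1 / s)) * ‖l‖) ^ (-(K : ℝ)) ≤ 1 := fun l =>
    Real.rpow_le_one_of_one_le_of_nonpos (le_add_of_nonneg_right (by positivity)) (by simp)
  have hb0 : ∀ l, 0 ≤ b l := fun l => by positivity
  have hbsum : Summable b := by
    refine ((hKsum ξ).1.mul_left (C * Aχ)).of_nonneg_of_le hb0 fun l => ?_
    calc b l ≤ C * 1 * (Aχ * (1 + ‖ξ - intVec l‖) ^ (-(K : ℝ))) := by
          simp only [hb]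
          gcongr
          exacts [hdec l, hχdecay _]
      _ = _ := by ring
  have hβ := (hAsum ξ).1.mul_left (4 * C * η * c ^ (n + 1) * B * Aχ * gfun n s ‖ξ‖)
  have hgξ := gfun_pos n s ‖ξ‖
  refine (norm_ftRmn_mul_FM_sub_le hφi hφc hφ1 (fun q => (hΨ q).1) hsum hPfin hPne
    (fun q hq => ne_zero_of_mem_QM hs hM hq.1) θ (hχ.continuous.integrable_of_hasCompactSupport hχc)
    ξ hbsum hb0 (fun q hq j => ?_) hβ (fun l => by positivity) fun l hl => ?_).trans ?_
  · have hq0 := one_le_norm_of_ne_zero (ne_zero_of_mem_QM hs hM hq.1)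
    have h1 : ((2 : ℝ) ^ k) ^ (-(1 / s)) * ‖tens j q‖ ≤ ‖Ψ q • intVec j‖ := by
      have h2 := rpow_neg_inv_le_PsiStar hΨ hs hM hq.1
      rw [PsiStar, le_div_iff₀ (by linarith)] at h2
      rw [norm_tens, norm_smul, norm_intVec, Real.norm_of_nonneg (hΨ q).1.le]
      calc ((2 : ℝ) ^ k) ^ (-(1 / s)) * (‖j‖ * ‖q‖) =
            ((2 : ℝ) ^ k) ^ (-(1 / s)) * ‖q‖ * ‖j‖ := by ring
        _ ≤ _ := by gcongr
    refine mul_le_mul_of_nonneg_right ((hdecay _).trans ?_) (norm_nonneg _)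
    refine mul_le_mul_of_nonneg_left ?_ hC.le
    exact Real.rpow_le_rpow_of_nonpos (by positivity) (by linarith) (by simp)
  · by_cases hlL : l ∈ LM m n (2 ^ k)
    · have h1 : QM' m Q Ψ s (2 ^ k) ∩ Dset m n l = ∅ := by
        refine Set.eq_empty_of_forall_notMem fun q hq => hq.1.2 ?_
        exact Set.mem_biUnion hlL hq.2
      rw [h1, Set.ncard_empty, Nat.cast_zero, zero_mul, mul_zero]
      positivity
    have hkl' := hkl l hl hlL
    have hlT : T ≤ ‖l‖ := by
      have h1 : Real.log T ≤ Real.log ‖l‖ := le_of_mul_le_mul_left (hkT.trans hkl') hc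
      exact (Real.log_le_log_iff (by linarith)
        (by linarith [one_le_norm_of_ne_zero hl])).1 h1
    obtain ⟨⟨hgl, hDl⟩, hl3⟩ := hT _ hlT
    have hDfin : (Dset m n l).Finite := by
      obtain ⟨p, hp⟩ := Function.ne_iff.1 hl
      exact (Dset_finite_ncard_le hp).1
    have hD : ((QM' m Q Ψ s (2 ^ k) ∩ Dset m n l).ncard : ℝ) ≤ η * wfun 1 ‖l‖ :=
      (Nat.cast_le.2 (Set.ncard_le_ncard Set.inter_subset_right hDfin)).trans (hDl l hl rfl)
    have h1 := inv_mul_mul_rpow_le_gfun hs hsK hk0 hl3 hC.le hη.le hkl' hN (Nat.cast_nonneg _) hD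
    have h2 : gfun n s ‖l‖ ≤ B * gfun n s ‖ξ‖ * (1 + v l) ^ s := by
      refine hgl _ _ (norm_nonneg _) (norm_nonneg _) ?_
      rw [← norm_intVec l]
      exact abs_norm_sub_norm_le _ _
    have h3 : (1 + v l) ^ s * (1 + v l) ^ (-(K : ℝ)) = (1 + v l) ^ (-(K - s)) := by
      rw [← Real.rpow_add (by positivity)]
      congr 1
      ring
    calc _ = ((QM' m Q Ψ s (2 ^ k)).ncard : ℝ)⁻¹ *
          ((QM' m Q Ψ s (2 ^ k) ∩ Dset m n l).ncard *
            (C * (1 + ((2 : ℝ) ^ k) ^ (-(1 / s)) * ‖l‖) ^ (-(K : ℝ)))) *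
          ‖ftPi (fun x => (χ x : ℂ)) (ξ - intVec l)‖ := by simp only [hb]; ring
      _ ≤ 4 * C * η * c ^ (n + 1) * (B * gfun n s ‖ξ‖ * (1 + v l) ^ s) *
          (Aχ * (1 + v l) ^ (-(K : ℝ))) := by
        exact mul_le_mul (h1.trans (by gcongr)) (hχdecay _) (norm_nonneg _) (by positivity)
      _ = 4 * C * η * c ^ (n + 1) * B * Aχ * gfun n s ‖ξ‖ *
          ((1 + v l) ^ s * (1 + v l) ^ (-(K : ℝ))) := by ring
      _ = _ := by rw [h3]
  · rw [tsum_mul_left]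
    calc _ ≤ 4 * C * η * c ^ (n + 1) * B * Aχ * gfun n s ‖ξ‖ * A := by
          gcongr
          exact (hAsum ξ).2
      _ = δ * gfun n s ‖ξ‖ := by
          rw [hηdef]
          field_simp
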